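/- arXiv:1405.3251 — 6 statements merged into one kernel-verified Lean document; each statement's English description precedes it below -/
import Mathlib

section
/- Let D = { y ∈ (-1,1) : −Φ⁻[y,1] < Φ⁺[-1,1] } be the set of points where the singular release point β is defined. Then D is an interval whose right endpoint is 1, and the function β : D → (-1,1) is continuous and strictly decreasing; moreover β(y) → −1 as y → 1. -/
open Set Filter Topology in
/-- Along a filter, convergence of the values of a strictly monotone function on an interval
forces convergence of the arguments. -/
theorem StrictMonoOn.tendsto_of_tendsto_comp {ι : Type*} {l : Filter ι} {F : ℝ → ℝ} {u v b : ℝ}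
    (hF : StrictMonoOn F (Icc u v)) {g : ι → ℝ} (hg : ∀ᶠ i in l, g i ∈ Icc u v)
    (hb : b ∈ Icc u v) (h : Tendsto (fun i => F (g i)) l (𝓝 (F b))) : Tendsto g l (𝓝 b) := by
  refine tendsto_order.2 ⟨fun a ha => ?_, fun a ha => ?_⟩
  · rcases lt_or_ge a u with hau | hau
    · filter_upwards [hg] with i hi using hau.trans_le hi.1
    · have haI : a ∈ Icc u v := ⟨hau, ha.le.trans hb.2⟩
      filter_upwards [hg, h.eventually_const_lt (hF haI hb ha)] with i hi hlt
      exact (hF.lt_iff_lt haI hi).1 hlt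
  · rcases lt_or_ge v a with hva | hva
    · filter_upwards [hg] with i hi using hi.2.trans_lt hva
    · have haI : a ∈ Icc u v := ⟨hb.1.trans ha.le, hva⟩
      filter_upwards [hg, h.eventually_lt_const (hF hb haI ha)] with i hi hlt
      exact (hF.lt_iff_lt hi haI).1 hlt

open Set in
/-- The primitive of a continuous function that is positive on the open interval is strictly
monotone. -/
theorem strictMonoOn_primitive_of_pos {f : ℝ → ℝ} {u v : ℝ} (hf : ContinuousOn f (Icc u v))
    (hpos : ∀ x ∈ Ioo u v, 0 < f x) : StrictMonoOn (fun x => ∫ t in u..x, f t) (Icc u v) := by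
  intro x hx y hy hxy
  have hux := (hf.mono (Icc_subset_Icc_right hx.2)).intervalIntegrable_of_Icc
      (μ := MeasureTheory.volume) hx.1
  have hxy' := (hf.mono (Icc_subset_Icc hx.1 hy.2)).intervalIntegrable_of_Icc
      (μ := MeasureTheory.volume) hxy.le
  have hint := intervalIntegral.integral_add_adjacent_intervals hux hxy'
  have := intervalIntegral.intervalIntegral_pos_of_pos_on hxy'
    (fun t ht => hpos t ⟨hx.1.trans_lt ht.1, ht.2.trans_le hy.2⟩) hxy
  simp only
  linarith

open Set in
/-- For a continuous function that is negative on the open interval, minus the integral up to the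
right endpoint is strictly decreasing and continuous. -/
theorem strictAntiOn_continuousOn_neg_integral_right {f : ℝ → ℝ} {u v : ℝ} (huv : u ≤ v)
    (hf : ContinuousOn f (Icc u v)) (hneg : ∀ x ∈ Ioo u v, f x < 0) :
    StrictAntiOn (fun x => -∫ t in x..v, f t) (Icc u v) ∧
      ContinuousOn (fun x => -∫ t in x..v, f t) (Icc u v) := by
  have hmono := strictMonoOn_primitive_of_pos hf.neg (fun x hx => neg_pos.2 (hneg x hx))
  have hcont : ContinuousOn (fun x => ∫ t in u..x, f t) (Icc u v) := by
    simpa [uIcc_of_le huv] using intervalIntegral.continuousOn_primitive_interval'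
      (hf.intervalIntegrable_of_Icc
      (μ := MeasureTheory.volume) huv) left_mem_uIcc
  have heq : ∀ x ∈ Icc u v,
      (-∫ t in x..v, f t) = (∫ t in u..x, f t) - ∫ t in u..v, f t := fun x hx => by
    have hux := (hf.mono (Icc_subset_Icc_right hx.2)).intervalIntegrable_of_Icc
      (μ := MeasureTheory.volume) hx.1
    have hxv := (hf.mono (Icc_subset_Icc_left hx.1)).intervalIntegrable_of_Icc
      (μ := MeasureTheory.volume) hx.2
    linarith [intervalIntegral.integral_add_adjacent_intervals hux hxv]
  refine ⟨fun x hx y hy hxy => ?_, (hcont.sub continuousOn_const).congr heq⟩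
  have := hmono hx hy hxy
  simp only [Pi.neg_apply, intervalIntegral.integral_neg] at this
  simp only [heq x hx, heq y hy]
  linarith

/- STATEMENT 2 (properties of the singular release point β):
Let D = { y ∈ (-1,1) : −Φ⁻[y,1] < Φ⁺[-1,1] } be the set of points where the
singular release point β is defined (β(y) ∈ (-1,1) and Φ⁻[y,1] + Φ⁺[-1,β(y)] = 0).
Then D is an interval whose right endpoint is 1, β is continuous and strictly
decreasing on D, and β(y) → −1 as y → 1⁻. -/
theorem beta_continuous_strictly_decreasing
    (lamP lamM : ℝ → ℝ)
    (hPc : ContinuousOn lamP (Set.Icc (-1) 1))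
    (hMc : ContinuousOn lamM (Set.Icc (-1) 1))
    (hP : ∀ y ∈ Set.Ioo (-1:ℝ) 1, 0 < lamP y)
    (hM : ∀ y ∈ Set.Ioo (-1:ℝ) 1, lamM y < 0)
    (D : Set ℝ)
    (hD : D = {y | y ∈ Set.Ioo (-1:ℝ) 1 ∧
      -(∫ t in y..1, lamM t) < ∫ t in (-1:ℝ)..1, lamP t})
    (β : ℝ → ℝ)
    (hβ : ∀ y ∈ D, β y ∈ Set.Ioo (-1:ℝ) 1 ∧
      (∫ t in y..1, lamM t) + (∫ t in (-1:ℝ)..(β y), lamP t) = 0) :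
    (∃ c ∈ Set.Ico (-1:ℝ) 1, D = Set.Ioo c 1) ∧
    ContinuousOn β D ∧
    StrictAntiOn β D ∧
    Filter.Tendsto β (nhdsWithin 1 (Set.Iio 1)) (nhds (-1)) := by
  have hF := strictMonoOn_primitive_of_pos hPc hP
  obtain ⟨hG, hGc⟩ := strictAntiOn_continuousOn_neg_integral_right (by norm_num) hMc hM
  set F : ℝ → ℝ := fun x => ∫ t in (-1 : ℝ)..x, lamP t with hFdef
  set G : ℝ → ℝ := fun y => -∫ t in y..1, lamM t with hGdef
  have hl : (-1 : ℝ) ∈ Set.Icc (-1 : ℝ) 1 := by norm_num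
  have hr : (1 : ℝ) ∈ Set.Icc (-1 : ℝ) 1 := by norm_num
  have hF0 : F (-1) = 0 := by simp [hFdef]
  have hG0 : G 1 = 0 := by simp [hGdef]
  have hF1 : 0 < F 1 := hF0 ▸ hF hl hr (by norm_num)
  have hmem : ∀ y, y ∈ D ↔ y ∈ Set.Ioo (-1 : ℝ) 1 ∧ G y < F 1 := fun y => by rw [hD]; rfl
  have hDsub : D ⊆ Set.Icc (-1) 1 := fun y hy => Set.Ioo_subset_Icc_self ((hmem y).1 hy).1
  have hβI : ∀ y ∈ D, β y ∈ Set.Icc (-1 : ℝ) 1 := fun y hy =>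
    Set.Ioo_subset_Icc_self (hβ y hy).1
  have hFβ : ∀ y ∈ D, F (β y) = G y := fun y hy => by
    have := (hβ y hy).2
    simp only [hFdef, hGdef]
    linarith
  obtain ⟨c, hc, hDc⟩ : ∃ c ∈ Set.Ico (-1 : ℝ) 1, D = Set.Ioo c 1 := by
    rcases le_or_gt (G (-1)) (F 1) with h | h
    · refine ⟨-1, by norm_num, Set.ext fun y => ?_⟩
      rw [hmem]
      exact ⟨And.left, fun hy => ⟨hy, (hG hl (Set.Ioo_subset_Icc_self hy) hy.1).trans_le h⟩⟩
    · obtain ⟨c, hc, hGc1⟩ := intermediate_value_Icc' (by norm_num) hGc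
        (show F 1 ∈ Set.Icc (G 1) (G (-1)) from ⟨hG0 ▸ hF1.le, h.le⟩)
      have hc1 : c < 1 := hc.2.lt_of_ne fun h1 => by
        rw [h1, hG0] at hGc1
        exact hF1.ne hGc1
      refine ⟨c, ⟨hc.1, hc1⟩, Set.ext fun y => ?_⟩
      rw [hmem, ← hGc1]
      constructor
      · rintro ⟨hy, hlt⟩
        exact ⟨(hG.lt_iff_gt (Set.Ioo_subset_Icc_self hy) hc).1 hlt, hy.2⟩
      · intro hy
        have hyI : y ∈ Set.Ioo (-1 : ℝ) 1 := ⟨hc.1.trans_lt hy.1, hy.2⟩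
        exact ⟨hyI, hG hc (Set.Ioo_subset_Icc_self hyI) hy.1⟩
  refine ⟨⟨c, hc, hDc⟩, fun y hy => ?_, fun y hy z hz hyz => ?_, ?_⟩
  · refine hF.tendsto_of_tendsto_comp (eventually_mem_nhdsWithin.mono hβI) (hβI y hy) ?_
    rw [hFβ y hy]
    exact ((hGc.mono hDsub) y hy).tendsto.congr'
      (eventually_mem_nhdsWithin.mono fun z hz => (hFβ z hz).symm)
  · rw [← hF.lt_iff_lt (hβI z hz) (hβI y hy), hFβ z hz, hFβ y hy]
    exact hG (hDsub hy) (hDsub hz) hyz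
  · have hev : ∀ᶠ y in nhdsWithin (1 : ℝ) (Set.Iio 1), y ∈ D :=
      hDc ▸ Ioo_mem_nhdsLT hc.2
    refine hF.tendsto_of_tendsto_comp (hev.mono hβI) hl ?_
    rw [hF0, ← hG0]
    have hle : nhdsWithin (1 : ℝ) (Set.Iio 1) ≤ nhdsWithin 1 (Set.Icc (-1) 1) :=
      nhdsWithin_le_of_mem (hev.mono hDsub)
    exact ((hGc 1 hr).tendsto.mono_left hle).congr' (hev.mono fun z hz => (hFβ z hz).symm)
end

section
/- Assume β(y) is defined for every y ∈ [a_0, b_{-1}], and assume both systems of strict integral inequalities hold. Then the following inclusions hold for every i = 1,…,n+1: if i is odd, β([a_{2i-2}, a_{2i+1}]) ⋐ ω^b_i and β([b_{2i+1}, b_{2i-2}]) ⋐ ω^a_i; if i is even, [a_{2i-2}, a_{2i+1}] ⋐ β(ω^b_i) and [b_{2i+1}, b_{2i-2}] ⋐ β(ω^a_i). Here A ⋐ B means that the closure of A is contained in the interior of B. -/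
open Set

/-- `Phi lam u v = ∫_u^v lam(t) dt`, the accumulated expansion/contraction. -/
noncomputable def Phi (lam : ℝ → ℝ) (u v : ℝ) : ℝ := ∫ t in u..v, lam t

/-- On a nondegenerate interval, the integral of a function that is positive in the interior
is positive. -/
lemma Phi_pos {lam : ℝ → ℝ} (hc : ContinuousOn lam (Icc (-1) 1))
    (hpos : ∀ y ∈ Ioo (-1 : ℝ) 1, 0 < lam y) {u v : ℝ} (hu : -1 ≤ u) (huv : u < v) (hv : v ≤ 1) :
    0 < Phi lam u v := by
  apply intervalIntegral.intervalIntegral_pos_of_pos_on _ _ huv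
  · exact (hc.mono (Icc_subset_Icc hu hv)).intervalIntegrable_of_Icc huv.le
  · exact fun x hx => hpos x ⟨hu.trans_lt hx.1, hx.2.trans_le hv⟩

lemma Phi_neg_fun (lam : ℝ → ℝ) (u v : ℝ) : Phi (fun t => -lam t) u v = -Phi lam u v :=
  intervalIntegral.integral_neg

lemma Phi_add_adjacent {lam : ℝ → ℝ} (hc : ContinuousOn lam (Icc (-1) 1)) {u v w : ℝ}
    (hu : u ∈ Icc (-1 : ℝ) 1) (hv : v ∈ Icc (-1 : ℝ) 1) (hw : w ∈ Icc (-1 : ℝ) 1) :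
    Phi lam u v + Phi lam v w = Phi lam u w :=
  intervalIntegral.integral_add_adjacent_intervals
    (hc.mono (uIcc_subset_Icc hu hv)).intervalIntegrable
    (hc.mono (uIcc_subset_Icc hv hw)).intervalIntegrable

lemma strictMonoOn_Phi_left {lam : ℝ → ℝ} (hc : ContinuousOn lam (Icc (-1) 1))
    (hpos : ∀ y ∈ Ioo (-1 : ℝ) 1, 0 < lam y) : StrictMonoOn (Phi lam (-1)) (Icc (-1) 1) := by
  intro x hx y hy hxy
  have h := Phi_add_adjacent hc (u := -1) (by simp) hx hy
  have := Phi_pos hc hpos hx.1 hxy hy.2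
  linarith

lemma strictAntiOn_neg_Phi_right {lam : ℝ → ℝ} (hc : ContinuousOn lam (Icc (-1) 1))
    (hneg : ∀ y ∈ Ioo (-1 : ℝ) 1, lam y < 0) :
    StrictAntiOn (fun y => -Phi lam y 1) (Icc (-1) 1) := by
  intro x hx y hy hxy
  have h := Phi_add_adjacent hc hx hy (w := 1) (by simp)
  have : 0 < Phi (fun t => -lam t) x y :=
    Phi_pos hc.neg (fun z hz => neg_pos.2 (hneg z hz)) hx.1 hxy hy.2
  have := Phi_neg_fun lam x y
  linarith

lemma Phi_le_Phi_left {lam : ℝ → ℝ} (hc : ContinuousOn lam (Icc (-1) 1))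
    (hpos : ∀ y ∈ Ioo (-1 : ℝ) 1, 0 < lam y) {u v : ℝ} (hu : u ∈ Icc (-1 : ℝ) 1)
    (hv : v ∈ Icc (-1 : ℝ) 1) : Phi lam u v ≤ Phi lam (-1) v := by
  have h := Phi_add_adjacent hc (u := -1) (by simp) hu hv
  have := (strictMonoOn_Phi_left hc hpos).monotoneOn (a := -1) (by simp) hu hu.1
  have h0 : Phi lam (-1) (-1) = 0 := intervalIntegral.integral_same
  linarith

lemma neg_Phi_le_neg_Phi_right {lam : ℝ → ℝ} (hc : ContinuousOn lam (Icc (-1) 1))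
    (hneg : ∀ y ∈ Ioo (-1 : ℝ) 1, lam y < 0) {u v : ℝ} (hu : u ∈ Icc (-1 : ℝ) 1)
    (hv : v ∈ Icc (-1 : ℝ) 1) : -Phi lam u v ≤ -Phi lam u 1 := by
  have h := Phi_add_adjacent hc hu hv (w := 1) (by simp)
  have := (strictAntiOn_neg_Phi_right hc hneg).antitoneOn hv (b := 1) (by simp) hv.2
  have h0 : Phi lam 1 1 = 0 := intervalIntegral.integral_same
  linarith

lemma continuousOn_neg_Phi_right {lam : ℝ → ℝ} (hc : ContinuousOn lam (Icc (-1) 1)) :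
    ContinuousOn (fun y => -Phi lam y 1) (Icc (-1) 1) := by
  have hi : MeasureTheory.IntegrableOn lam (uIcc (-1) 1) := by
    rw [uIcc_of_le (by norm_num)]
    exact hc.integrableOn_Icc
  have h := (intervalIntegral.continuousOn_primitive_interval_left hi).neg
  rwa [uIcc_of_le (by norm_num)] at h

/-- Monotonicity on `[k, m + 3]` from monotonicity of the steps up to `m` and of the last two. -/
lemma monotoneOn_Icc_add_three {α : Type*} [Preorder α] {f : ℤ → α} {k m : ℤ}
    (hf : ∀ i, k ≤ i → i ≤ m → f i ≤ f (i + 1)) (h₁ : f (m + 1) ≤ f (m + 2))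
    (h₂ : f (m + 2) ≤ f (m + 3)) : MonotoneOn f (Icc k (m + 3)) := by
  refine monotoneOn_of_le_add_one ordConnected_Icc fun i _ hi hi' => ?_
  obtain h | rfl | rfl : i ≤ m ∨ i = m + 1 ∨ i = m + 2 := by
    have := hi'.2
    lia
  · exact hf i hi.1 h
  · rwa [add_assoc, one_add_one_eq_two]
  · rwa [show m + 2 + 1 = m + 3 by ring]

/-- If `F (β y) = G y` with `F` strictly increasing and `G` decreasing, then `β` maps `[c, d]`
compactly inside `[p, q]` as soon as the endpoint inequalities hold strictly. -/
lemma closure_image_Icc_subset_interior {F G β : ℝ → ℝ} {s t : Set ℝ} (hF : StrictMonoOn F s)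
    (hG : AntitoneOn G t) (hβs : MapsTo β t s) (hβ : ∀ y ∈ t, F (β y) = G y) {c d p q : ℝ}
    (hcd : c ≤ d) (ht : Icc c d ⊆ t) (hp : p ∈ s) (hq : q ∈ s) (h₁ : F p < G d)
    (h₂ : G c < F q) : closure (β '' Icc c d) ⊆ interior (Icc p q) := by
  have hc := ht (left_mem_Icc.2 hcd)
  have hd := ht (right_mem_Icc.2 hcd)
  have hsub : β '' Icc c d ⊆ Icc (β d) (β c) := by
    rintro _ ⟨y, hy, rfl⟩
    have hyt := ht hy
    rw [mem_Icc, ← hF.le_iff_le (hβs hd) (hβs hyt), ← hF.le_iff_le (hβs hyt) (hβs hc),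
      hβ y hyt, hβ c hc, hβ d hd]
    exact ⟨hG hyt hd hy.2, hG hc hyt hy.1⟩
  rw [interior_Icc]
  refine (closure_minimal hsub isClosed_Icc).trans (Icc_subset_Ioo ?_ ?_)
  · rwa [← hF.lt_iff_lt hp (hβs hd), hβ d hd]
  · rwa [← hF.lt_iff_lt (hβs hc) hq, hβ c hc]

/-- If `F (β y) = G y` with `F` strictly increasing and `G` continuous, then the image of `[c, d]`
under `β` contains `[u, v]` compactly as soon as the endpoint inequalities hold strictly. -/
lemma closure_Icc_subset_interior_image {F G β : ℝ → ℝ} {s t : Set ℝ} (hs : s.OrdConnected)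
    (hF : StrictMonoOn F s) (hG : ContinuousOn G t) (hβs : MapsTo β t s)
    (hβ : ∀ y ∈ t, F (β y) = G y) {c d u v : ℝ}
    (hcd : c ≤ d) (ht : Icc c d ⊆ t) (hu : u ∈ s) (hv : v ∈ s) (h₁ : F v < G c)
    (h₂ : G d < F u) : closure (Icc u v) ⊆ interior (β '' Icc c d) := by
  have hc := ht (left_mem_Icc.2 hcd)
  have hd := ht (right_mem_Icc.2 hcd)
  have hlow : β d < u := by rwa [← hF.lt_iff_lt (hβs hd) hu, hβ d hd]
  have hupp : v < β c := by rwa [← hF.lt_iff_lt hv (hβs hc), hβ c hc]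
  rw [closure_Icc]
  refine (Icc_subset_Ioo hlow hupp).trans (interior_maximal ?_ isOpen_Ioo)
  intro x hx
  have hxs : x ∈ s := hs.out (hβs hd) (hβs hc) (Ioo_subset_Icc_self hx)
  have hx₁ : G d ≤ F x := by rw [← hβ d hd]; exact hF.monotoneOn (hβs hd) hxs hx.1.le
  have hx₂ : F x ≤ G c := by rw [← hβ c hc]; exact hF.monotoneOn hxs (hβs hc) hx.2.le
  obtain ⟨y, hy, hyx⟩ := intermediate_value_Icc' hcd (hG.mono ht) ⟨hx₁, hx₂⟩
  exact ⟨y, hy, hF.injOn (hβs (ht hy)) hxs ((hβ y (ht hy)).trans hyx)⟩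

/-- The inclusions of the theorem, from inequalities between the values of `F = Φ⁺[-1, ·]` and
`G = -Φ⁻[·, 1]` at the endpoints. -/
lemma inclusions_of_endpoint_inequalities {n : ℕ} {a b : ℤ → ℝ} {F G β : ℝ → ℝ} {s t : Set ℝ}
    (hS : s.OrdConnected) (hT : t.OrdConnected) (hF : StrictMonoOn F s) (hGa : AntitoneOn G t)
    (hGc : ContinuousOn G t) (hβS : MapsTo β t s) (hβFG : ∀ y ∈ t, F (β y) = G y)
    (ha : MonotoneOn a (Icc (-1) (2 * (n : ℤ) + 3)))
    (hb : AntitoneOn b (Icc (-1) (2 * (n : ℤ) + 3)))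
    (haT : ∀ i : ℤ, 0 ≤ i → i ≤ 2 * n + 3 → a i ∈ t)
    (hbT : ∀ i : ℤ, -1 ≤ i → i ≤ 2 * n + 3 → b i ∈ t)
    (haS : ∀ i : ℤ, -1 ≤ i → i ≤ 2 * n + 3 → a i ∈ s)
    (hbS : ∀ i : ℤ, -1 ≤ i → i ≤ 2 * n + 3 → b i ∈ s)
    (hc1 : b (2 * (n : ℤ) + 2) = a (2 * (n : ℤ) + 1))
    (hc2 : a (2 * (n : ℤ) + 2) = b (2 * (n : ℤ) + 1))
    (hc3 : a (2 * (n : ℤ) + 3) = b (2 * (n : ℤ)))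
    (hc4 : b (2 * (n : ℤ) + 3) = a (2 * (n : ℤ)))
    (odd₁ : ∀ i : ℤ, Odd i → 1 ≤ i → i ≤ n → F (b (2 * i)) < G (a (2 * i + 1)))
    (odd₂ : ∀ i : ℤ, Odd i → 1 ≤ i → i ≤ n + 1 → F (a (2 * i - 1)) < G (b (2 * i - 2)))
    (even₁ : ∀ i : ℤ, Even i → 0 ≤ i → i ≤ n → G (a (2 * i)) < F (b (2 * i + 1)))
    (even₂ : ∀ i : ℤ, Even i → 1 ≤ i → i ≤ n + 1 → G (b (2 * i - 1)) < F (a (2 * i - 2)))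
    {i : ℤ} (hi₁ : 1 ≤ i) (hin : i ≤ n + 1) :
    (Odd i →
      closure (β '' Icc (a (2 * i - 2)) (a (2 * i + 1))) ⊆
        interior (Icc (b (2 * i)) (b (2 * i - 1))) ∧
      closure (β '' Icc (b (2 * i + 1)) (b (2 * i - 2))) ⊆
        interior (Icc (a (2 * i - 1)) (a (2 * i)))) ∧
    (Even i →
      closure (Icc (a (2 * i - 2)) (a (2 * i + 1))) ⊆
        interior (β '' Icc (b (2 * i)) (b (2 * i - 1))) ∧
      closure (Icc (b (2 * i + 1)) (b (2 * i - 2))) ⊆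
        interior (β '' Icc (a (2 * i - 1)) (a (2 * i)))) := by
  refine ⟨fun hi => ⟨?_, ?_⟩, fun hi => ⟨?_, ?_⟩⟩
  · refine closure_image_Icc_subset_interior hF hGa hβS hβFG
      (ha ⟨by lia, by lia⟩ ⟨by lia, by lia⟩ (by lia))
      (hT.out (haT _ (by lia) (by lia)) (haT _ (by lia) (by lia)))
      (hbS _ (by lia) (by lia)) (hbS _ (by lia) (by lia)) ?_ ?_
    · obtain h | rfl : i ≤ n ∨ i = n + 1 := by lia
      · exact odd₁ i hi hi₁ h
      · convert odd₂ _ hi hi₁ le_rfl using 2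
        · rw [mul_add, mul_one, hc1]
          congr 1
          ring
        · rw [show 2 * ((n : ℤ) + 1) + 1 = 2 * n + 3 by ring, hc3]
          congr 2
          ring
    · convert even₁ (i - 1) (by grind) (by lia) (by lia) using 4 <;> ring
  · refine closure_image_Icc_subset_interior hF hGa hβS hβFG
      (hb ⟨by lia, by lia⟩ ⟨by lia, by lia⟩ (by lia))
      (hT.out (hbT _ (by lia) (by lia)) (hbT _ (by lia) (by lia)))
      (haS _ (by lia) (by lia)) (haS _ (by lia) (by lia)) (odd₂ i hi hi₁ hin) ?_
    obtain h | rfl : i ≤ n ∨ i = n + 1 := by lia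
    · convert even₂ (i + 1) (by grind) (by lia) (by lia) using 4 <;> ring
    · convert even₁ n (by grind) (by lia) le_rfl using 2
      · rw [show 2 * ((n : ℤ) + 1) + 1 = 2 * n + 3 by ring, hc4]
      · rw [mul_add, mul_one, hc2]
  · refine closure_Icc_subset_interior_image hS hF hGc hβS hβFG
      (hb ⟨by lia, by lia⟩ ⟨by lia, by lia⟩ (by lia))
      (hT.out (hbT _ (by lia) (by lia)) (hbT _ (by lia) (by lia)))
      (haS _ (by lia) (by lia)) (haS _ (by lia) (by lia)) ?_ (even₂ i hi hi₁ hin)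
    obtain h | rfl : i ≤ n ∨ i = n + 1 := by lia
    · convert odd₂ (i + 1) (by grind) (by lia) (by lia) using 4 <;> ring
    · convert odd₁ n (by grind) (by grind) le_rfl using 2
      · rw [show 2 * ((n : ℤ) + 1) + 1 = 2 * n + 3 by ring, hc3]
      · rw [mul_add, mul_one, hc1]
  · refine closure_Icc_subset_interior_image hS hF hGc hβS hβFG
      (ha ⟨by lia, by lia⟩ ⟨by lia, by lia⟩ (by lia))
      (hT.out (haT _ (by lia) (by lia)) (haT _ (by lia) (by lia)))
      (hbS _ (by lia) (by lia)) (hbS _ (by lia) (by lia)) ?_ ?_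
    · convert odd₁ (i - 1) (by grind) (by grind) (by lia) using 4 <;> ring
    · obtain h | rfl : i ≤ n ∨ i = n + 1 := by lia
      · exact even₁ i hi (by lia) h
      · convert even₂ _ hi hi₁ le_rfl using 2
        · rw [mul_add, mul_one, hc2]
          congr 2
          ring
        · rw [show 2 * ((n : ℤ) + 1) + 1 = 2 * n + 3 by ring, hc4]
          congr 1
          ring

/- STATEMENT 4 (Proposition 3 of the paper: the integral inequalities imply the
inclusions).  Points −1 = a_{-1} < a_0 < ⋯ < a_{2n+1} < b_{2n+1} < ⋯ < b_{-1} < 1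
with conventions b_{2n+2} = a_{2n+1}, a_{2n+2} = b_{2n+1}, a_{2n+3} = b_{2n},
b_{2n+3} = a_{2n}; ω^a_i = [a_{2i-1}, a_{2i}], ω^b_i = [b_{2i}, b_{2i-1}].
Assume β(y) is defined on [a_0, b_{-1}] and the two systems of strict inequalities
hold.  Then for every i = 1,…,n+1: if i is odd, β([a_{2i-2}, a_{2i+1}]) ⋐ ω^b_i and
β([b_{2i+1}, b_{2i-2}]) ⋐ ω^a_i; if i is even, [a_{2i-2}, a_{2i+1}] ⋐ β(ω^b_i) and
[b_{2i+1}, b_{2i-2}] ⋐ β(ω^a_i).  (A ⋐ B means closure A ⊆ interior B.) -/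
theorem inclusions_from_integral_inequalities
    (n : ℕ) (a b : ℤ → ℝ) (lamP lamM : ℝ → ℝ) (β : ℝ → ℝ)
    (hPc : ContinuousOn lamP (Icc (-1) 1))
    (hMc : ContinuousOn lamM (Icc (-1) 1))
    (hP : ∀ y ∈ Ioo (-1:ℝ) 1, 0 < lamP y)
    (hM : ∀ y ∈ Ioo (-1:ℝ) 1, lamM y < 0)
    (ham : a (-1) = -1)
    (haInc : ∀ i : ℤ, -1 ≤ i → i ≤ 2*(n:ℤ) → a i < a (i+1))
    (hab : a (2*(n:ℤ)+1) < b (2*(n:ℤ)+1))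
    (hbDec : ∀ i : ℤ, -1 ≤ i → i ≤ 2*(n:ℤ) → b (i+1) < b i)
    (hbm : b (-1) < 1)
    (hc1 : b (2*(n:ℤ)+2) = a (2*(n:ℤ)+1))
    (hc2 : a (2*(n:ℤ)+2) = b (2*(n:ℤ)+1))
    (hc3 : a (2*(n:ℤ)+3) = b (2*(n:ℤ)))
    (hc4 : b (2*(n:ℤ)+3) = a (2*(n:ℤ)))
    (hβ : ∀ y ∈ Icc (a 0) (b (-1)), β y ∈ Ioo (-1:ℝ) 1 ∧
      Phi lamM y 1 + Phi lamP (-1) (β y) = 0)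
    (hOdd1 : ∀ i : ℤ, Odd i → 1 ≤ i → i ≤ (n:ℤ) →
      Phi lamP (-1) (b (2*i)) < -(Phi lamM (a (2*i+1)) (a (2*i+2))))
    (hOdd2 : ∀ i : ℤ, Odd i → 1 ≤ i → i ≤ (n:ℤ)+1 →
      Phi lamP (-1) (a (2*i-1)) < -(Phi lamM (b (2*i-2)) (b (2*i-3))))
    (hEven1 : ∀ i : ℤ, Even i → 0 ≤ i → i ≤ (n:ℤ) →
      -(Phi lamM (a (2*i)) 1) < Phi lamP (b (2*i+2)) (b (2*i+1)))
    (hEven2 : ∀ i : ℤ, Even i → 1 ≤ i → i ≤ (n:ℤ)+1 →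
      -(Phi lamM (b (2*i-1)) 1) < Phi lamP (a (2*i-3)) (a (2*i-2))) :
    ∀ i : ℤ, 1 ≤ i → i ≤ (n:ℤ)+1 →
      (Odd i →
        closure (β '' Icc (a (2*i-2)) (a (2*i+1))) ⊆
          interior (Icc (b (2*i)) (b (2*i-1))) ∧
        closure (β '' Icc (b (2*i+1)) (b (2*i-2))) ⊆
          interior (Icc (a (2*i-1)) (a (2*i)))) ∧
      (Even i →
        closure (Icc (a (2*i-2)) (a (2*i+1))) ⊆
          interior (β '' Icc (b (2*i)) (b (2*i-1))) ∧
        closure (Icc (b (2*i+1)) (b (2*i-2))) ⊆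
          interior (β '' Icc (a (2*i-1)) (a (2*i)))) := by
  have ha : MonotoneOn a (Icc (-1) (2 * (n : ℤ) + 3)) :=
    monotoneOn_Icc_add_three (fun i h h' => (haInc i h h').le) (hc2 ▸ hab.le)
      (by rw [hc2, hc3]; exact (hbDec _ (by lia) le_rfl).le)
  have hb : AntitoneOn b (Icc (-1) (2 * (n : ℤ) + 3)) :=
    (monotoneOn_Icc_add_three (f := OrderDual.toDual ∘ b) (fun i h h' => (hbDec i h h').le)
      (by simpa [hc1] using hab.le)
      (by simpa [hc1, hc4] using (haInc _ (by lia) le_rfl).le)).dual_right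
  have haT : ∀ i : ℤ, 0 ≤ i → i ≤ 2 * n + 3 → a i ∈ Icc (a 0) (b (-1)) := fun i h₀ h₁ =>
    ⟨ha ⟨by lia, by lia⟩ ⟨by lia, by lia⟩ h₀, by
      refine (ha ⟨by lia, by lia⟩ ⟨by lia, le_rfl⟩ h₁).trans ?_
      rw [hc3]
      exact hb ⟨by lia, by lia⟩ ⟨by lia, by lia⟩ (by lia)⟩
  have hbT : ∀ i : ℤ, -1 ≤ i → i ≤ 2 * n + 3 → b i ∈ Icc (a 0) (b (-1)) := fun i h₀ h₁ =>
    ⟨by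
      refine le_trans ?_ (hb ⟨by lia, by lia⟩ ⟨by lia, le_rfl⟩ h₁)
      rw [hc4]
      exact ha ⟨by lia, by lia⟩ ⟨by lia, by lia⟩ (by lia),
    hb ⟨by lia, by lia⟩ ⟨by lia, by lia⟩ h₀⟩
  have ha0 : -1 ≤ a 0 := ham ▸ ha ⟨by lia, by lia⟩ ⟨by lia, by lia⟩ (by lia)
  have hT : Icc (a 0) (b (-1)) ⊆ Icc (-1 : ℝ) 1 := Icc_subset_Icc ha0 hbm.le
  have haS : ∀ i : ℤ, -1 ≤ i → i ≤ 2 * n + 3 → a i ∈ Icc (-1 : ℝ) 1 := fun i h₀ h₁ => by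
    obtain rfl | h := h₀.eq_or_lt
    · simp [ham]
    · exact hT (haT i (by lia) h₁)
  have hbS : ∀ i : ℤ, -1 ≤ i → i ≤ 2 * n + 3 → b i ∈ Icc (-1 : ℝ) 1 := fun i h₀ h₁ =>
    hT (hbT i h₀ h₁)
  have hF := strictMonoOn_Phi_left hPc hP
  have hGa := (strictAntiOn_neg_Phi_right hMc hM).antitoneOn.mono hT
  have hGc := (continuousOn_neg_Phi_right hMc).mono hT
  have hβS : MapsTo β (Icc (a 0) (b (-1))) (Icc (-1) 1) := fun y hy =>
    Ioo_subset_Icc_self (hβ y hy).1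
  have hβFG : ∀ y ∈ Icc (a 0) (b (-1)), Phi lamP (-1) (β y) = -Phi lamM y 1 := fun y hy => by
    linarith [(hβ y hy).2]
  have odd₂ : ∀ i : ℤ, Odd i → 1 ≤ i → i ≤ n + 1 →
      Phi lamP (-1) (a (2 * i - 1)) < -Phi lamM (b (2 * i - 2)) 1 := fun i hi h₁ h₂ =>
    (hOdd2 i hi h₁ h₂).trans_le <| neg_Phi_le_neg_Phi_right hMc hM
      (hbS _ (by lia) (by lia)) (hbS _ (by lia) (by lia))
  have odd₁ : ∀ i : ℤ, Odd i → 1 ≤ i → i ≤ n →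
      Phi lamP (-1) (b (2 * i)) < -Phi lamM (a (2 * i + 1)) 1 := fun i hi h₁ h₂ =>
    (hOdd1 i hi h₁ h₂).trans_le <| neg_Phi_le_neg_Phi_right hMc hM
      (haS _ (by lia) (by lia)) (haS _ (by lia) (by lia))
  have even₁ : ∀ i : ℤ, Even i → 0 ≤ i → i ≤ n →
      -Phi lamM (a (2 * i)) 1 < Phi lamP (-1) (b (2 * i + 1)) := fun i hi h₁ h₂ =>
    (hEven1 i hi h₁ h₂).trans_le <| Phi_le_Phi_left hPc hP
      (hbS _ (by lia) (by lia)) (hbS _ (by lia) (by lia))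
  have even₂ : ∀ i : ℤ, Even i → 1 ≤ i → i ≤ n + 1 →
      -Phi lamM (b (2 * i - 1)) 1 < Phi lamP (-1) (a (2 * i - 2)) := fun i hi h₁ h₂ =>
    (hEven2 i hi h₁ h₂).trans_le <| Phi_le_Phi_left hPc hP
      (haS _ (by lia) (by lia)) (haS _ (by lia) (by lia))
  exact fun i hi hin => inclusions_of_endpoint_inequalities ordConnected_Icc ordConnected_Icc
    hF hGa hGc hβS hβFG ha hb haT hbT haS hbS hc1 hc2 hc3 hc4 odd₁ odd₂ even₁ even₂ hi hin
end

section
/- Assume β(y) is defined for every y ∈ [a_0, b_{-1}], and assume the inclusions of Proposition 3 hold, i.e. for every i = 1,…,n+1: if i is odd, β([a_{2i-2}, a_{2i+1}]) ⋐ ω^b_i and β([b_{2i+1}, b_{2i-2}]) ⋐ ω^a_i; if i is even, [a_{2i-2}, a_{2i+1}] ⋐ β(ω^b_i) and [b_{2i+1}, b_{2i-2}] ⋐ β(ω^a_i). Then for every odd i with 1 ≤ i ≤ n+1 the composition β∘β maps the segment [a_{2i-2}, a_{2i+1}] into the interior of ω^a_i (in particular β∘β maps ω^a_i strictly into itself and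 has a fixed point in ω^a_i), and for every even i with 1 ≤ i ≤ n the image (β∘β)(ω^a_i) contains the closure of [a_{2i-2}, a_{2i+1}] in its interior (in particular ω^a_i ⋐ (β∘β)(ω^a_i) and β∘β has a fixed point in ω^a_i); the analogous statements hold for the segments ω^b_i, i = 1,…,n. -/
open Set

theorem square_fixedPoint_of_image_subset {f : ℝ → ℝ} {D S T B : Set ℝ} {p q : ℝ}
    (hf : ContinuousOn f D) (hpq : p ≤ q) (hAD : Icc p q ⊆ D) (hBD : B ⊆ D)
    (hAS : Icc p q ⊆ S) (hBT : B ⊆ T)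
    (hS : closure (f '' S) ⊆ interior B) (hT : closure (f '' T) ⊆ interior (Icc p q)) :
    ((fun y => f (f y)) '' S ⊆ interior (Icc p q)) ∧
      ((fun y => f (f y)) '' Icc p q ⊆ interior (Icc p q)) ∧
      ∃ y ∈ Icc p q, f (f y) = y := by
  have hSB : MapsTo f S B := fun x hx =>
    interior_subset (hS (subset_closure (mem_image_of_mem f hx)))
  have hTA : MapsTo f T (interior (Icc p q)) := fun x hx =>
    hT (subset_closure (mem_image_of_mem f hx))
  have hSA : (fun y => f (f y)) '' S ⊆ interior (Icc p q) := by
    rintro _ ⟨x, hx, rfl⟩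
    exact hTA (hBT (hSB hx))
  refine ⟨hSA, (image_mono hAS).trans hSA, ?_⟩
  have hcont : ContinuousOn (fun y => f (f y)) (Icc p q) :=
    hf.comp (hf.mono hAD) fun x hx => hBD (hSB (hAS hx))
  exact exists_mem_Icc_isFixedPt_of_mapsTo hcont hpq fun x hx =>
    interior_subset (hSA (mem_image_of_mem _ (hAS hx)))

/-- Values of `f` outside `D` play no role: the fixed point is found on the part of `[p, q]`
that `f` sends into `[r, s]`. -/
theorem exists_square_fixedPoint_of_subset_image {f : ℝ → ℝ} {D : Set ℝ} {p q r s : ℝ}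
    (hf : ContinuousOn f D) (hanti : AntitoneOn f D) (hrs : r < s)
    (hAD : Icc p q ⊆ D) (hBD : Icc r s ⊆ D)
    (hA : Icc p q ⊆ f '' Icc r s) (hB : Icc r s ⊆ f '' Icc p q) :
    ∃ y ∈ Icc p q, f (f y) = y := by
  obtain ⟨u, hu, hus⟩ := hB (right_mem_Icc.2 hrs.le)
  obtain ⟨v, hv, hvr⟩ := hB (left_mem_Icc.2 hrs.le)
  have huv : u ≤ v := by
    by_contra! h
    have := hanti (hAD hv) (hAD hu) h.le
    linarith
  have hsub : Icc u v ⊆ Icc p q := Icc_subset_Icc hu.1 hv.2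
  have hmaps : MapsTo f (Icc u v) (Icc r s) := fun x hx =>
    ⟨hvr ▸ hanti (hAD (hsub hx)) (hAD hv) hx.2, hus ▸ hanti (hAD hu) (hAD (hsub hx)) hx.1⟩
  have hcont : ContinuousOn (fun y => f (f y)) (Icc u v) :=
    hf.comp (hf.mono (hsub.trans hAD)) fun x hx => hBD (hmaps hx)
  have hfu : f (f u) ≤ u := by
    obtain ⟨x, hx, hxu⟩ := hA hu
    rw [hus]
    exact (hanti (hBD hx) (hBD (right_mem_Icc.2 hrs.le)) hx.2).trans_eq hxu
  have hfv : v ≤ f (f v) := by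
    obtain ⟨x, hx, hxv⟩ := hA hv
    rw [hvr]
    exact hxv.symm.trans_le (hanti (hBD (left_mem_Icc.2 hrs.le)) (hBD hx) hx.1)
  obtain ⟨y, hy, hfix⟩ := isPreconnected_Icc.intermediate_value₂
    (left_mem_Icc.2 huv) (right_mem_Icc.2 huv) hcont continuousOn_id hfu hfv
  exact ⟨y, hsub hy, hfix⟩

theorem square_fixedPoint_of_subset_image {f : ℝ → ℝ} {D S T : Set ℝ} {p q r s : ℝ}
    (hf : ContinuousOn f D) (hanti : AntitoneOn f D) (hrs : r < s)
    (hAD : Icc p q ⊆ D) (hBD : Icc r s ⊆ D)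
    (hAS : Icc p q ⊆ S) (hBT : Icc r s ⊆ T)
    (hS : closure S ⊆ interior (f '' Icc r s)) (hT : closure T ⊆ interior (f '' Icc p q)) :
    (closure S ⊆ interior ((fun y => f (f y)) '' Icc p q)) ∧
      (closure (Icc p q) ⊆ interior ((fun y => f (f y)) '' Icc p q)) ∧
      ∃ y ∈ Icc p q, f (f y) = y := by
  have hB : Icc r s ⊆ f '' Icc p q :=
    hBT.trans (subset_closure.trans (hT.trans interior_subset))
  have hA : Icc p q ⊆ f '' Icc r s :=
    hAS.trans (subset_closure.trans (hS.trans interior_subset))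
  have hSA : closure S ⊆ interior ((fun y => f (f y)) '' Icc p q) := by
    refine hS.trans (interior_mono ?_)
    rw [← image_image f f (Icc p q)]
    exact image_mono hB
  exact ⟨hSA, (closure_mono hAS).trans hSA,
    exists_square_fixedPoint_of_subset_image hf hanti hrs hAD hBD hA hB⟩

/- STATEMENT 5 (fixed points of β∘β from the inclusions of Proposition 3):
Under the inclusions of Proposition 3, for every odd i with 1 ≤ i ≤ n+1 the map
β∘β sends [a_{2i-2}, a_{2i+1}] into the interior of ω^a_i (in particular β∘β maps
ω^a_i strictly into itself and has a fixed point in ω^a_i), and for every even i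
with 1 ≤ i ≤ n the image (β∘β)(ω^a_i) contains the closure of [a_{2i-2}, a_{2i+1}]
in its interior (in particular ω^a_i ⋐ (β∘β)(ω^a_i) and β∘β has a fixed point in
ω^a_i); the analogous statements hold for ω^b_i, i = 1,…,n. -/
theorem beta_square_fixed_points
    (n : ℕ) (a b : ℤ → ℝ) (lamP lamM : ℝ → ℝ) (β : ℝ → ℝ)
    (hPc : ContinuousOn lamP (Icc (-1) 1))
    (hMc : ContinuousOn lamM (Icc (-1) 1))
    (hP : ∀ y ∈ Ioo (-1:ℝ) 1, 0 < lamP y)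
    (hM : ∀ y ∈ Ioo (-1:ℝ) 1, lamM y < 0)
    (ham : a (-1) = -1)
    (haInc : ∀ i : ℤ, -1 ≤ i → i ≤ 2*(n:ℤ) → a i < a (i+1))
    (hab : a (2*(n:ℤ)+1) < b (2*(n:ℤ)+1))
    (hbDec : ∀ i : ℤ, -1 ≤ i → i ≤ 2*(n:ℤ) → b (i+1) < b i)
    (hbm : b (-1) < 1)
    (hc1 : b (2*(n:ℤ)+2) = a (2*(n:ℤ)+1))
    (hc2 : a (2*(n:ℤ)+2) = b (2*(n:ℤ)+1))
    (hc3 : a (2*(n:ℤ)+3) = b (2*(n:ℤ)))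
    (hc4 : b (2*(n:ℤ)+3) = a (2*(n:ℤ)))
    (hβ : ∀ y ∈ Icc (a 0) (b (-1)), β y ∈ Ioo (-1:ℝ) 1 ∧
      Phi lamM y 1 + Phi lamP (-1) (β y) = 0)
    (hβcont : ContinuousOn β (Icc (a 0) (b (-1))))
    (hβanti : StrictAntiOn β (Icc (a 0) (b (-1))))
    (hincl : ∀ i : ℤ, 1 ≤ i → i ≤ (n:ℤ)+1 →
      (Odd i →
        closure (β '' Icc (a (2*i-2)) (a (2*i+1))) ⊆
          interior (Icc (b (2*i)) (b (2*i-1))) ∧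
        closure (β '' Icc (b (2*i+1)) (b (2*i-2))) ⊆
          interior (Icc (a (2*i-1)) (a (2*i)))) ∧
      (Even i →
        closure (Icc (a (2*i-2)) (a (2*i+1))) ⊆
          interior (β '' Icc (b (2*i)) (b (2*i-1))) ∧
        closure (Icc (b (2*i+1)) (b (2*i-2))) ⊆
          interior (β '' Icc (a (2*i-1)) (a (2*i))))) :
    (∀ i : ℤ, Odd i → 1 ≤ i → i ≤ (n:ℤ)+1 →
      ((fun y => β (β y)) '' Icc (a (2*i-2)) (a (2*i+1)) ⊆
        interior (Icc (a (2*i-1)) (a (2*i)))) ∧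
      ((fun y => β (β y)) '' Icc (a (2*i-1)) (a (2*i)) ⊆
        interior (Icc (a (2*i-1)) (a (2*i)))) ∧
      (∃ y ∈ Icc (a (2*i-1)) (a (2*i)), β (β y) = y)) ∧
    (∀ i : ℤ, Even i → 1 ≤ i → i ≤ (n:ℤ) →
      (closure (Icc (a (2*i-2)) (a (2*i+1))) ⊆
        interior ((fun y => β (β y)) '' Icc (a (2*i-1)) (a (2*i)))) ∧
      (closure (Icc (a (2*i-1)) (a (2*i))) ⊆
        interior ((fun y => β (β y)) '' Icc (a (2*i-1)) (a (2*i)))) ∧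
      (∃ y ∈ Icc (a (2*i-1)) (a (2*i)), β (β y) = y)) ∧
    (∀ i : ℤ, Odd i → 1 ≤ i → i ≤ (n:ℤ) →
      ((fun y => β (β y)) '' Icc (b (2*i+1)) (b (2*i-2)) ⊆
        interior (Icc (b (2*i)) (b (2*i-1)))) ∧
      ((fun y => β (β y)) '' Icc (b (2*i)) (b (2*i-1)) ⊆
        interior (Icc (b (2*i)) (b (2*i-1)))) ∧
      (∃ y ∈ Icc (b (2*i)) (b (2*i-1)), β (β y) = y)) ∧
    (∀ i : ℤ, Even i → 1 ≤ i → i ≤ (n:ℤ) →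
      (closure (Icc (b (2*i+1)) (b (2*i-2))) ⊆
        interior ((fun y => β (β y)) '' Icc (b (2*i)) (b (2*i-1)))) ∧
      (closure (Icc (b (2*i)) (b (2*i-1))) ⊆
        interior ((fun y => β (β y)) '' Icc (b (2*i)) (b (2*i-1)))) ∧
      (∃ y ∈ Icc (b (2*i)) (b (2*i-1)), β (β y) = y)) := by
  have ha : StrictMonoOn a (Icc (-1) (2 * (n : ℤ) + 3)) := by
    refine strictMonoOn_of_lt_add_one ordConnected_Icc fun i _ hi hi' => ?_
    have hlt : i ≤ 2 * (n : ℤ) ∨ i = 2 * (n : ℤ) + 1 ∨ i = 2 * (n : ℤ) + 2 := by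
      have := hi'.2
      omega
    rcases hlt with h | rfl | rfl
    · exact haInc i hi.1 h
    · rw [show 2 * (n : ℤ) + 1 + 1 = 2 * n + 2 by ring, hc2]
      exact hab
    · rw [show 2 * (n : ℤ) + 2 + 1 = 2 * n + 3 by ring, hc2, hc3]
      exact hbDec _ (by omega) le_rfl
  have hb : StrictAntiOn b (Icc (-1) (2 * (n : ℤ) + 3)) := by
    refine strictAntiOn_of_add_one_lt ordConnected_Icc fun i _ hi hi' => ?_
    have hlt : i ≤ 2 * (n : ℤ) ∨ i = 2 * (n : ℤ) + 1 ∨ i = 2 * (n : ℤ) + 2 := by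
      have := hi'.2
      omega
    rcases hlt with h | rfl | rfl
    · exact hbDec i hi.1 h
    · rw [show 2 * (n : ℤ) + 1 + 1 = 2 * n + 2 by ring, hc1]
      exact hab
    · rw [show 2 * (n : ℤ) + 2 + 1 = 2 * n + 3 by ring, hc1, hc4]
      exact haInc _ (by omega) le_rfl
  have hale : ∀ i j : ℤ, -1 ≤ i → i ≤ j → j ≤ 2 * (n : ℤ) + 3 → a i ≤ a j := fun i j h1 h2 h3 =>
    ha.monotoneOn ⟨h1, h2.trans h3⟩ ⟨h1.trans h2, h3⟩ h2
  have hble : ∀ i j : ℤ, -1 ≤ i → i ≤ j → j ≤ 2 * (n : ℤ) + 3 → b j ≤ b i := fun i j h1 h2 h3 =>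
    hb.antitoneOn ⟨h1, h2.trans h3⟩ ⟨h1.trans h2, h3⟩ h2
  have hcent_a : a (2 * (n : ℤ) + 3) ≤ b (-1) :=
    hc3.trans_le (hble _ _ le_rfl (by omega) (by omega))
  have hcent_b : a 0 ≤ b (2 * (n : ℤ) + 3) :=
    (hale _ _ (by omega) (by omega) (by omega)).trans_eq hc4.symm
  have hAD : ∀ i : ℤ, 1 ≤ i → i ≤ (n : ℤ) + 1 →
      Icc (a (2*i-1)) (a (2*i)) ⊆ Icc (a 0) (b (-1)) := fun i h1 h2 =>
    Icc_subset_Icc (hale _ _ (by omega) (by omega) (by omega))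
      ((hale _ _ (by omega) (by omega) (by omega)).trans hcent_a)
  have hBD : ∀ i : ℤ, 1 ≤ i → i ≤ (n : ℤ) + 1 →
      Icc (b (2*i)) (b (2*i-1)) ⊆ Icc (a 0) (b (-1)) := fun i h1 h2 =>
    Icc_subset_Icc (hcent_b.trans (hble _ _ (by omega) (by omega) (by omega)))
      (hble _ _ (by omega) (by omega) (by omega))
  have hAS : ∀ i : ℤ, 1 ≤ i → i ≤ (n : ℤ) + 1 →
      Icc (a (2*i-1)) (a (2*i)) ⊆ Icc (a (2*i-2)) (a (2*i+1)) := fun i h1 h2 =>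
    Icc_subset_Icc (hale _ _ (by omega) (by omega) (by omega))
      (hale _ _ (by omega) (by omega) (by omega))
  have hBT : ∀ i : ℤ, 1 ≤ i → i ≤ (n : ℤ) + 1 →
      Icc (b (2*i)) (b (2*i-1)) ⊆ Icc (b (2*i+1)) (b (2*i-2)) := fun i h1 h2 =>
    Icc_subset_Icc (hble _ _ (by omega) (by omega) (by omega))
      (hble _ _ (by omega) (by omega) (by omega))
  have halt : ∀ i : ℤ, 1 ≤ i → i ≤ (n : ℤ) + 1 → a (2*i-1) < a (2*i) := fun i h1 h2 =>
    ha ⟨by omega, by omega⟩ ⟨by omega, by omega⟩ (by omega)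
  have hblt : ∀ i : ℤ, 1 ≤ i → i ≤ (n : ℤ) + 1 → b (2*i) < b (2*i-1) := fun i h1 h2 =>
    hb ⟨by omega, by omega⟩ ⟨by omega, by omega⟩ (by omega)
  refine ⟨fun i hi h1 h2 => ?_, fun i hi h1 h2 => ?_, fun i hi h1 h2 => ?_,
    fun i hi h1 h2 => ?_⟩
  · obtain ⟨hS, hT⟩ := (hincl i h1 h2).1 hi
    exact square_fixedPoint_of_image_subset hβcont (halt i h1 h2).le (hAD i h1 h2) (hBD i h1 h2)
      (hAS i h1 h2) (hBT i h1 h2) hS hT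
  · replace h2 : i ≤ (n : ℤ) + 1 := by omega
    obtain ⟨hS, hT⟩ := (hincl i h1 h2).2 hi
    exact square_fixedPoint_of_subset_image hβcont hβanti.antitoneOn (hblt i h1 h2)
      (hAD i h1 h2) (hBD i h1 h2) (hAS i h1 h2) (hBT i h1 h2) hS hT
  · replace h2 : i ≤ (n : ℤ) + 1 := by omega
    obtain ⟨hS, hT⟩ := (hincl i h1 h2).1 hi
    exact square_fixedPoint_of_image_subset hβcont (hblt i h1 h2).le (hBD i h1 h2) (hAD i h1 h2)
      (hBT i h1 h2) (hAS i h1 h2) hT hS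
  · replace h2 : i ≤ (n : ℤ) + 1 := by omega
    obtain ⟨hS, hT⟩ := (hincl i h1 h2).2 hi
    exact square_fixedPoint_of_subset_image hβcont hβanti.antitoneOn (halt i h1 h2)
      (hBD i h1 h2) (hAD i h1 h2) (hBT i h1 h2) (hAS i h1 h2) hT hS
end

section
/- For every n ∈ ℕ and every choice of points −1 < a_0 < a_1 < ⋯ < a_{2n+1} < b_{2n+1} < b_{2n} < ⋯ < b_1 < b_0 < b_{-1} < 1, there exist smooth functions λ⁺, λ⁻ : [-1,1] → ℝ such that: λ⁺(y) > 0 and λ⁻(y) < 0 for all y ∈ (-1,1); λ⁺(±1) = λ⁻(±1) = 0; λ⁺ and λ⁻ are constant on each of the segments ω^a_i (i = 1,…,n+1) and ω^b_i (i = 1,…,n); and both systems of strict integral inequalities hold. -/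
open Set

lemma Phi_le_of_eq_zero {f : ℝ → ℝ} {h c d u v : ℝ} (hf : Continuous f) (h0 : 0 ≤ h)
    (hfh : ∀ y, f y ≤ h) (huv : u ≤ v) (hcd : c ≤ d)
    (hz : ∀ y ∈ Ioc u v, y ∉ Icc c d → f y = 0) : Phi f u v ≤ h * (d - c) := by
  rw [Phi, intervalIntegral.integral_of_le huv]
  have hle : ∫ y in Ioc u v, f y ≤ ∫ y in Ioc u v, (Icc c d).indicator (fun _ => h) y := by
    refine MeasureTheory.setIntegral_mono_on (hf.integrableOn_Ioc) ?_ measurableSet_Ioc ?_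
    · exact (MeasureTheory.integrable_const h).indicator measurableSet_Icc
    · intro y hy
      by_cases hyc : y ∈ Icc c d
      · simpa [hyc] using hfh y
      · simp [hyc, hz y hy hyc]
  refine hle.trans ?_
  rw [MeasureTheory.setIntegral_indicator measurableSet_Icc, MeasureTheory.setIntegral_const,
    smul_eq_mul, mul_comm]
  refine mul_le_mul_of_nonneg_left ?_ h0
  calc MeasureTheory.volume.real (Ioc u v ∩ Icc c d)
      ≤ MeasureTheory.volume.real (Icc c d) :=
        MeasureTheory.measureReal_mono inter_subset_right measure_Icc_lt_top.ne
    _ = d - c := by simp [hcd]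

lemma exists_smooth_plateau {s t l r m η : ℝ} (hls : l < s) (hst : s < t) (htr : t < r)
    (hm : 0 ≤ m) (hη : 0 < η) :
    ∃ ψ : ℝ → ℝ, ContDiff ℝ (⊤ : ℕ∞) ψ ∧ (∀ y, 0 ≤ ψ y) ∧
      (∀ y ∈ Icc s t, ψ y = m / (t - s)) ∧ (∀ y, y ∉ Ioo l r → ψ y = 0) ∧
      (∀ u v, u ≤ v → Phi ψ u v ≤ m + η) ∧
      (∀ u v, u ≤ v → v ≤ s ∨ t ≤ u → Phi ψ u v ≤ η) := by
  have hts : 0 < t - s := sub_pos.2 hst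
  set h := m / (t - s) with hh
  have h0 : 0 ≤ h := by positivity
  have hm' : h * (t - s) = m := div_mul_cancel₀ _ hts.ne'
  obtain ⟨δ, hδ, hδl, hδr, hδη⟩ :
      ∃ δ : ℝ, 0 < δ ∧ δ ≤ s - l ∧ δ ≤ r - t ∧ h * (2 * δ) ≤ η := by
    refine ⟨min (min (s - l) (r - t)) (η / (2 * (h + 1))), ?_, ?_, ?_, ?_⟩
    · have : 0 < η / (2 * (h + 1)) := by positivity
      simp [hls, htr, this]
    · exact (min_le_left _ _).trans (min_le_left _ _)
    · exact (min_le_left _ _).trans (min_le_right _ _)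
    · calc h * (2 * min (min (s - l) (r - t)) (η / (2 * (h + 1))))
          ≤ h * (2 * (η / (2 * (h + 1)))) := by gcongr; exact min_le_right _ _
        _ = η * (h / (h + 1)) := by field_simp
        _ ≤ η * 1 := by
            gcongr
            rw [div_le_one (by positivity)]; linarith
        _ = η := mul_one η
  let σ := Real.smoothTransition
  let ψ : ℝ → ℝ := fun y => h * (σ ((y - s) / δ + 1) * σ ((t - y) / δ + 1))
  have hsm : ContDiff ℝ (⊤ : ℕ∞) ψ := by
    refine contDiff_const.mul (ContDiff.mul ?_ ?_)
    · exact Real.smoothTransition.contDiff.comp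
        (((contDiff_id.sub contDiff_const).div_const δ).add contDiff_const)
    · exact Real.smoothTransition.contDiff.comp
        (((contDiff_const.sub contDiff_id).div_const δ).add contDiff_const)
  have hnn : ∀ y, 0 ≤ ψ y := fun y => mul_nonneg h0
    (mul_nonneg (Real.smoothTransition.nonneg _) (Real.smoothTransition.nonneg _))
  have hle : ∀ y, ψ y ≤ h := fun y => mul_le_of_le_one_right h0
    (mul_le_one₀ (Real.smoothTransition.le_one _) (Real.smoothTransition.nonneg _)
      (Real.smoothTransition.le_one _))
  have hzero : ∀ y, y ∉ Ioo (s - δ) (t + δ) → ψ y = 0 := by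
    intro y hy
    rcases le_or_gt y (s - δ) with h1 | h1
    · have : σ ((y - s) / δ + 1) = 0 := by
        apply Real.smoothTransition.zero_of_nonpos
        have : (y - s) / δ ≤ -1 := by rw [div_le_iff₀ hδ]; linarith
        linarith
      simp [ψ, this]
    · have h2 : t + δ ≤ y := by
        by_contra hlt
        exact hy ⟨h1, not_le.1 hlt⟩
      have : σ ((t - y) / δ + 1) = 0 := by
        apply Real.smoothTransition.zero_of_nonpos
        have : (t - y) / δ ≤ -1 := by rw [div_le_iff₀ hδ]; linarith
        linarith
      simp [ψ, this]
  refine ⟨ψ, hsm, hnn, ?_, ?_, ?_, ?_⟩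
  · rintro y ⟨h1, h2⟩
    have e1 : σ ((y - s) / δ + 1) = 1 := by
      apply Real.smoothTransition.one_of_one_le
      have : 0 ≤ (y - s) / δ := div_nonneg (by linarith) hδ.le
      linarith
    have e2 : σ ((t - y) / δ + 1) = 1 := by
      apply Real.smoothTransition.one_of_one_le
      have : 0 ≤ (t - y) / δ := div_nonneg (by linarith) hδ.le
      linarith
    simp [ψ, e1, e2]
  · intro y hy
    exact hzero y fun hy' => hy ⟨by linarith [hy'.1], by linarith [hy'.2]⟩
  · intro u v huv
    refine (Phi_le_of_eq_zero hsm.continuous h0 hle huv (c := s - δ) (d := t + δ)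
      (by linarith) fun y _ hy => hzero y fun hy' => hy (Ioo_subset_Icc_self hy')).trans ?_
    nlinarith
  · rintro u v huv (hv | hu)
    · refine (Phi_le_of_eq_zero hsm.continuous h0 hle huv (c := s - δ) (d := s)
        (by linarith) fun y hy hyc => hzero y fun hy' =>
          hyc ⟨hy'.1.le, hy.2.trans hv⟩).trans ?_
      nlinarith
    · refine (Phi_le_of_eq_zero hsm.continuous h0 hle huv (c := t) (d := t + δ)
        (by linarith) fun y hy hyc => hzero y fun hy' =>
          hyc ⟨hu.trans hy.1.le, hy'.2.le⟩).trans ?_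
      nlinarith

/-- A smooth function on `[-1, 1]`, positive inside and zero at the endpoints, that is constant on
each of finitely many segments `[s i, t i]`, has mass at least `m i` on each of them and mass at
most `1 / 2` on their complement. -/
lemma exists_smooth_with_masses {ι : Type*} (I : Finset ι) {s t l r m : ι → ℝ} {c d : ℝ}
    (hc : -1 < c) (hd : d < 1) (hcs : ∀ i ∈ I, c ≤ s i) (htd : ∀ i ∈ I, t i ≤ d)
    (hls : ∀ i ∈ I, l i < s i) (hst : ∀ i ∈ I, s i < t i) (htr : ∀ i ∈ I, t i < r i)
    (hdisj : ∀ i ∈ I, ∀ j ∈ I, i ≠ j → t j ≤ l i ∨ r i ≤ s j)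
    (hm : ∀ i ∈ I, 0 ≤ m i) :
    ∃ lam : ℝ → ℝ, ContDiff ℝ (⊤ : ℕ∞) lam ∧ (∀ y ∈ Ioo (-1 : ℝ) 1, 0 < lam y) ∧
      lam (-1) = 0 ∧ lam 1 = 0 ∧
      (∀ i ∈ I, ∃ C : ℝ, ∀ y ∈ Icc (s i) (t i), lam y = C) ∧
      (∀ i ∈ I, m i ≤ Phi lam (s i) (t i)) ∧
      (∀ u v, -1 ≤ u → u ≤ v → v ≤ 1 → ∀ K ⊆ I, (∀ i ∈ I, i ∉ K → v ≤ s i ∨ t i ≤ u) →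
        Phi lam u v ≤ 1 / 2 + ∑ i ∈ K, m i) := by
  classical
  set η : ℝ := 1 / (4 * (I.card + 1)) with hη
  have hη0 : 0 < η := by positivity
  have hcard : I.card * η ≤ 1 / 4 := by
    rw [hη, mul_one_div, div_le_iff₀ (by positivity)]
    linarith
  have hbump : ∀ i, ∃ ψ : ℝ → ℝ, i ∈ I → ContDiff ℝ (⊤ : ℕ∞) ψ ∧ (∀ y, 0 ≤ ψ y) ∧
      (∀ y ∈ Icc (s i) (t i), ψ y = m i / (t i - s i)) ∧ (∀ y, y ∉ Ioo (l i) (r i) → ψ y = 0) ∧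
      (∀ u v, u ≤ v → Phi ψ u v ≤ m i + η) ∧
      (∀ u v, u ≤ v → v ≤ s i ∨ t i ≤ u → Phi ψ u v ≤ η) := by
    intro i
    by_cases hi : i ∈ I
    · obtain ⟨ψ, h⟩ := exists_smooth_plateau (hls i hi) (hst i hi) (htr i hi) (hm i hi) hη0
      exact ⟨ψ, fun _ => h⟩
    · exact ⟨0, fun h => absurd h hi⟩
  choose ψ hψ using hbump
  let σ := Real.smoothTransition
  let g : ℝ → ℝ := fun y => σ ((y + 1) / (c + 1)) * σ ((1 - y) / (1 - d))
  let F : ℝ → ℝ := fun y => 1 / 8 + ∑ i ∈ I, ψ i y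
  have hc' : 0 < c + 1 := by linarith
  have hd' : 0 < 1 - d := by linarith
  have hg : ContDiff ℝ (⊤ : ℕ∞) g := by
    refine ContDiff.mul ?_ ?_
    · exact Real.smoothTransition.contDiff.comp
        ((contDiff_id.add contDiff_const).div_const _)
    · exact Real.smoothTransition.contDiff.comp
        ((contDiff_const.sub contDiff_id).div_const _)
  have hg1 : ∀ y, g y ≤ 1 := fun y =>
    mul_le_one₀ (Real.smoothTransition.le_one _) (Real.smoothTransition.nonneg _)
      (Real.smoothTransition.le_one _)
  have hg_eq : ∀ y ∈ Icc c d, g y = 1 := by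
    rintro y ⟨h1, h2⟩
    have e1 : σ ((y + 1) / (c + 1)) = 1 := by
      apply Real.smoothTransition.one_of_one_le
      rw [one_le_div hc']; linarith
    have e2 : σ ((1 - y) / (1 - d)) = 1 := by
      apply Real.smoothTransition.one_of_one_le
      rw [one_le_div hd']; linarith
    simp [g, e1, e2]
  have hF : ContDiff ℝ (⊤ : ℕ∞) F :=
    contDiff_const.add (ContDiff.sum fun i hi => (hψ i hi).1)
  have hF0 : ∀ y, 0 < F y := fun y => by
    have : 0 ≤ ∑ i ∈ I, ψ i y := Finset.sum_nonneg fun i hi => (hψ i hi).2.1 y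
    simp only [F]; linarith
  have hval : ∀ i ∈ I, ∀ y ∈ Icc (s i) (t i), g y * F y = 1 / 8 + m i / (t i - s i) := by
    intro i hi y hy
    rw [hg_eq y ⟨(hcs i hi).trans hy.1, hy.2.trans (htd i hi)⟩, one_mul]
    simp only [F]
    rw [Finset.sum_eq_single_of_mem i hi, (hψ i hi).2.2.1 y hy]
    intro j hj hji
    refine (hψ j hj).2.2.2.1 y fun hy' => ?_
    rcases hdisj j hj i hi hji with h | h
    · linarith [hy.2, hy'.1]
    · linarith [hy.1, hy'.2]
  refine ⟨fun y => g y * F y, hg.mul hF, ?_, ?_, ?_, fun i hi => ⟨_, hval i hi⟩, ?_, ?_⟩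
  · rintro y ⟨h1, h2⟩
    refine mul_pos (mul_pos ?_ ?_) (hF0 y) <;> apply Real.smoothTransition.pos_of_pos
    · exact div_pos (by linarith) hc'
    · exact div_pos (by linarith) hd'
  · simp [g, σ]
  · simp [g, σ]
  · intro i hi
    have hti : 0 < t i - s i := sub_pos.2 (hst i hi)
    have : Phi (fun y => g y * F y) (s i) (t i) =
        ∫ _ in (s i)..(t i), (1 / 8 + m i / (t i - s i)) := by
      refine intervalIntegral.integral_congr fun y hy => hval i hi y ?_
      rwa [uIcc_of_le (hst i hi).le] at hy
    rw [this, intervalIntegral.integral_const, smul_eq_mul, mul_add,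
      mul_div_cancel₀ _ hti.ne']
    linarith
  · intro u v hu huv hv K hK hout
    have hint : ∀ i ∈ I, IntervalIntegrable (ψ i) MeasureTheory.volume u v := fun i hi =>
      (hψ i hi).1.continuous.intervalIntegrable _ _
    have hsum : IntervalIntegrable (fun y => ∑ i ∈ I, ψ i y) MeasureTheory.volume u v :=
      (continuous_finsetSum I fun i hi => (hψ i hi).1.continuous).intervalIntegrable _ _
    calc Phi (fun y => g y * F y) u v ≤ Phi F u v := by
          refine intervalIntegral.integral_mono_on huv
            ((hg.mul hF).continuous.intervalIntegrable _ _)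
            (hF.continuous.intervalIntegrable _ _) fun y _ => ?_
          exact mul_le_of_le_one_left (hF0 y).le (hg1 y)
      _ = (v - u) * (1 / 8) + ∑ i ∈ I, Phi (ψ i) u v := by
          simp only [Phi, F]
          rw [intervalIntegral.integral_add (by simp) hsum,
            intervalIntegral.integral_finsetSum hint, intervalIntegral.integral_const, smul_eq_mul]
      _ ≤ (v - u) * (1 / 8) + ∑ i ∈ I, ((if i ∈ K then m i else 0) + η) := by
          gcongr with i hi
          split_ifs with hiK
          · exact (hψ i hi).2.2.2.2.1 u v huv
          · rw [zero_add]
            exact (hψ i hi).2.2.2.2.2 u v huv (hout i hi hiK)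
      _ = (v - u) * (1 / 8) + (∑ i ∈ K, m i + I.card * η) := by
          rw [Finset.sum_add_distrib, Finset.sum_ite_mem, Finset.inter_eq_right.2 hK,
            Finset.sum_const, nsmul_eq_mul]
      _ ≤ 1 / 2 + ∑ i ∈ K, m i := by linarith

lemma sum_range_even_powers (r : ℕ) :
    ∑ i ∈ Finset.range (2 * r), (if Even i then 3 * 4 ^ (i / 2) else 0 : ℝ) = 4 ^ r - 1 := by
  induction r with
  | zero => simp
  | succ r ih =>
    rw [Nat.mul_succ, Finset.sum_range_succ, Finset.sum_range_succ, ih]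
    simp [parity_simps]
    ring

lemma sum_Ico_odd_powers (n k : ℕ) : ∀ r, r + k = n →
    ∑ i ∈ Finset.Ico (2 * r) (2 * n + 2), (if Even i then 0 else 3 / 2 * 4 ^ (n - i / 2) : ℝ) =
      (4 ^ (k + 1) - 1) / 2 := by
  induction k with
  | zero =>
    rintro r rfl
    have h : (2 * r + 1) / 2 = r := by omega
    rw [add_zero, Finset.sum_Ico_succ_top (by omega), Finset.sum_Ico_succ_top (by omega)]
    simp [parity_simps, h]
    norm_num
  | succ k ih =>
    intro r hr
    have h : (2 * r + 1) / 2 = r := by omega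
    have h' : n - r = k + 1 := by omega
    rw [Finset.sum_eq_sum_Ico_succ_bot (by omega), Finset.sum_eq_sum_Ico_succ_bot (by omega),
      show 2 * r + 1 + 1 = 2 * (r + 1) by ring, ih (r + 1) (by omega)]
    simp [parity_simps, h, h']
    ring

lemma exists_lambda_of_monotone_nodes (n : ℕ) (p : ℕ → ℝ)
    (hp : ∀ j ≤ 4 * n + 4, p j < p (j + 1)) (h0 : -1 < p 0) (h1 : p (4 * n + 4) < 1) :
    ∃ lamP lamM : ℝ → ℝ, ContDiff ℝ (⊤ : ℕ∞) lamP ∧ ContDiff ℝ (⊤ : ℕ∞) lamM ∧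
      (∀ y ∈ Ioo (-1 : ℝ) 1, 0 < lamP y ∧ lamM y < 0) ∧
      lamP (-1) = 0 ∧ lamP 1 = 0 ∧ lamM (-1) = 0 ∧ lamM 1 = 0 ∧
      (∀ i < 2 * n + 2, ∃ Cp Cm : ℝ,
        ∀ y ∈ Icc (p (2 * i + 1)) (p (2 * i + 2)), lamP y = Cp ∧ lamM y = Cm) ∧
      (∀ r k, r + k = n →
        Phi lamP (-1) (p (4 * r + 1)) < -(Phi lamM (p (4 * k + 3)) (p (4 * k + 4)))) ∧
      (∀ r k, r + k = n →
        -(Phi lamM (p (4 * r)) 1) < Phi lamP (p (4 * k + 1)) (p (4 * k + 2))) := by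
  have hmono : ∀ j, j ≤ 4 * n + 5 → ∀ i ≤ j, p i ≤ p j := by
    intro j
    induction j with
    | zero => intro _ i hi; rw [Nat.le_zero.1 hi]
    | succ j ih =>
      intro hj i hi
      rcases Nat.le_succ_iff.1 hi with h | rfl
      · exact (ih (by omega) i h).trans (hp j (by omega)).le
      · exact le_rfl
  have key := fun (m : ℕ → ℝ) (hm : ∀ i ∈ Finset.range (2 * n + 2), 0 ≤ m i) =>
    exists_smooth_with_masses (Finset.range (2 * n + 2)) (s := fun i => p (2 * i + 1))
      (t := fun i => p (2 * i + 2)) (l := fun i => p (2 * i)) (r := fun i => p (2 * i + 3))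
      (m := m) h0 h1
      (fun i hi => hmono _ (by simp at hi; omega) _ (by omega))
      (fun i hi => hmono _ (by omega) _ (by simp at hi; omega))
      (fun i hi => hp _ (by simp at hi; omega))
      (fun i hi => hp _ (by simp at hi; omega))
      (fun i hi => hp _ (by simp at hi; omega))
      (fun i hi j hj hij => by
        simp only [Finset.mem_range] at hi hj
        rcases lt_or_gt_of_ne hij with h | h
        · exact Or.inr (hmono _ (by omega) _ (by omega))
        · exact Or.inl (hmono _ (by omega) _ (by omega))) hm
  obtain ⟨lamP, hPs, hPpos, hPl, hPr, hPc, hPm, hPb⟩ :=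
    key (fun i => if Even i then 3 * 4 ^ (i / 2) else 0)
      (fun i _ => by split_ifs <;> positivity)
  obtain ⟨lamN, hNs, hNpos, hNl, hNr, hNc, hNm, hNb⟩ :=
    key (fun i => if Even i then 0 else 3 / 2 * 4 ^ (n - i / 2))
      (fun i _ => by split_ifs <;> positivity)
  have hneg : ∀ u v, -(Phi (fun y => -lamN y) u v) = Phi lamN u v := fun u v => by
    simp [Phi, intervalIntegral.integral_neg]
  refine ⟨lamP, fun y => -lamN y, hPs, hNs.neg,
    fun y hy => ⟨hPpos y hy, neg_lt_zero.2 (hNpos y hy)⟩, hPl, hPr, by simp [hNl], by simp [hNr],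
    ?_, ?_, ?_⟩
  · intro i hi
    obtain ⟨Cp, hCp⟩ := hPc i (Finset.mem_range.2 hi)
    obtain ⟨Cm, hCm⟩ := hNc i (Finset.mem_range.2 hi)
    exact ⟨Cp, -Cm, fun y hy => ⟨hCp y hy, congrArg Neg.neg (hCm y hy)⟩⟩
  · intro r k hrk
    rw [hneg]
    have hup := hPb (-1) (p (4 * r + 1)) le_rfl
      (h0.le.trans (hmono _ (by omega) _ (by omega)))
      ((hmono _ (by omega) _ (by omega)).trans h1.le) (Finset.range (2 * r))
      (Finset.range_subset_range.2 (by omega))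
      (fun i hi hiK => Or.inl (by
        simp only [Finset.mem_range] at hi hiK
        exact hmono _ (by omega) _ (by omega)))
    rw [sum_range_even_powers] at hup
    have hlow := hNm (2 * k + 1) (Finset.mem_range.2 (by omega))
    have hodd : ¬ Even (2 * k + 1) := by simp
    rw [if_neg hodd, show n - (2 * k + 1) / 2 = r by omega,
      show 2 * (2 * k + 1) + 1 = 4 * k + 3 by ring,
      show 2 * (2 * k + 1) + 2 = 4 * k + 4 by ring] at hlow
    have : (0 : ℝ) < 4 ^ r := by positivity
    linarith
  · intro r k hrk
    rw [hneg]
    have hup := hNb (p (4 * r)) 1 (h0.le.trans (hmono _ (by omega) _ (by omega)))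
      ((hmono _ (by omega) _ (by omega)).trans h1.le) le_rfl (Finset.Ico (2 * r) (2 * n + 2))
      (fun i hi => Finset.mem_range.2 (Finset.mem_Ico.1 hi).2)
      (fun i hi hiK => Or.inr (by
        simp only [Finset.mem_range, Finset.mem_Ico] at hi hiK
        exact hmono _ (by omega) _ (by omega)))
    rw [sum_Ico_odd_powers n k r hrk] at hup
    have hlow := hPm (2 * k) (Finset.mem_range.2 (by omega))
    rw [if_pos (even_two_mul k), show 2 * k / 2 = k by omega,
      show 2 * (2 * k) + 1 = 4 * k + 1 by ring,
      show 2 * (2 * k) + 2 = 4 * k + 2 by ring] at hlow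
    have : (0 : ℝ) < 4 ^ k := by positivity
    rw [pow_succ] at hup
    linarith

/- STATEMENT 6 (analytic core of Proposition 4 of the paper):
For every n ∈ ℕ and every choice of points
−1 < a_0 < a_1 < ⋯ < a_{2n+1} < b_{2n+1} < b_{2n} < ⋯ < b_1 < b_0 < b_{-1} < 1
(with the conventions b_{2n+2} = a_{2n+1}, a_{2n+2} = b_{2n+1}, a_{2n+3} = b_{2n}),
there exist smooth functions λ⁺, λ⁻ : [-1,1] → ℝ such that λ⁺ > 0 and λ⁻ < 0 on
(-1,1), λ⁺(±1) = λ⁻(±1) = 0, λ⁺ and λ⁻ are constant on each of the segments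
ω^a_i (i = 1,…,n+1) and ω^b_i (i = 1,…,n), and both systems of strict integral
inequalities hold. -/
theorem exists_lambda_with_inequalities
    (n : ℕ) (a b : ℤ → ℝ)
    (ham : -1 < a 0)
    (haInc : ∀ i : ℤ, 0 ≤ i → i ≤ 2*(n:ℤ) → a i < a (i+1))
    (hab : a (2*(n:ℤ)+1) < b (2*(n:ℤ)+1))
    (hbDec : ∀ i : ℤ, -1 ≤ i → i ≤ 2*(n:ℤ) → b (i+1) < b i)
    (hbm : b (-1) < 1)
    (hc1 : b (2*(n:ℤ)+2) = a (2*(n:ℤ)+1))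
    (hc2 : a (2*(n:ℤ)+2) = b (2*(n:ℤ)+1))
    (hc3 : a (2*(n:ℤ)+3) = b (2*(n:ℤ))) :
    ∃ lamP lamM : ℝ → ℝ,
      ContDiffOn ℝ (⊤ : ℕ∞) lamP (Icc (-1:ℝ) 1) ∧
      ContDiffOn ℝ (⊤ : ℕ∞) lamM (Icc (-1:ℝ) 1) ∧
      (∀ y ∈ Ioo (-1:ℝ) 1, 0 < lamP y ∧ lamM y < 0) ∧
      lamP (-1) = 0 ∧ lamP 1 = 0 ∧ lamM (-1) = 0 ∧ lamM 1 = 0 ∧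
      (∀ i : ℤ, 1 ≤ i → i ≤ (n:ℤ)+1 → ∃ Cp Cm : ℝ,
        ∀ y ∈ Icc (a (2*i-1)) (a (2*i)), lamP y = Cp ∧ lamM y = Cm) ∧
      (∀ i : ℤ, 1 ≤ i → i ≤ (n:ℤ) → ∃ Cp Cm : ℝ,
        ∀ y ∈ Icc (b (2*i)) (b (2*i-1)), lamP y = Cp ∧ lamM y = Cm) ∧
      (∀ i : ℤ, Odd i → 1 ≤ i → i ≤ (n:ℤ) →
        Phi lamP (-1) (b (2*i)) < -(Phi lamM (a (2*i+1)) (a (2*i+2)))) ∧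
      (∀ i : ℤ, Odd i → 1 ≤ i → i ≤ (n:ℤ)+1 →
        Phi lamP (-1) (a (2*i-1)) < -(Phi lamM (b (2*i-2)) (b (2*i-3)))) ∧
      (∀ i : ℤ, Even i → 0 ≤ i → i ≤ (n:ℤ) →
        -(Phi lamM (a (2*i)) 1) < Phi lamP (b (2*i+2)) (b (2*i+1))) ∧
      (∀ i : ℤ, Even i → 1 ≤ i → i ≤ (n:ℤ)+1 →
        -(Phi lamM (b (2*i-1)) 1) < Phi lamP (a (2*i-3)) (a (2*i-2))) := by
  let p : ℕ → ℝ := fun j => if j ≤ 2 * n + 1 then a j else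
    if j ≤ 4 * n + 4 then b (4 * n + 3 - j) else 1
  have hpa : ∀ (i : ℤ) (j : ℕ), i = j → j ≤ 2 * n + 3 → a i = p j := by
    rintro i j rfl hj
    simp only [p]
    rcases Nat.lt_or_ge (2 * n + 1) j with h | h
    · rw [if_neg (by omega), if_pos (by omega)]
      obtain rfl | rfl : j = 2 * n + 2 ∨ j = 2 * n + 3 := by omega
      · push_cast
        rw [hc2]; congr 1; ring
      · push_cast
        rw [hc3]; congr 1; ring
    · rw [if_pos h]
  have hpb : ∀ (i : ℤ) (j : ℕ), i = 4 * n + 3 - j → 2 * n + 1 ≤ j → j ≤ 4 * n + 4 →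
      b i = p j := by
    rintro i j rfl hj hj'
    simp only [p]
    rcases Nat.lt_or_ge (2 * n + 1) j with h | h
    · rw [if_neg (by omega), if_pos hj']
    · obtain rfl : j = 2 * n + 1 := by omega
      rw [if_pos le_rfl]
      push_cast
      rw [← hc1]; congr 1; ring
  have hp : ∀ j ≤ 4 * n + 4, p j < p (j + 1) := by
    intro j hj
    rcases lt_trichotomy j (2 * n + 1) with h | rfl | h
    · rw [← hpa j j rfl (by omega), ← hpa (j + 1) (j + 1) (by push_cast; rfl) (by omega)]
      exact haInc j (by omega) (by omega)
    · rw [← hpa (2 * n + 1) (2 * n + 1) (by push_cast; rfl) (by omega),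
        ← hpb (2 * n + 1) (2 * n + 1 + 1) (by push_cast; ring) (by omega) (by omega)]
      exact hab
    · rw [← hpb (4 * n + 3 - j) j rfl (by omega) hj]
      rcases Nat.lt_or_ge j (4 * n + 4) with h' | h'
      · rw [← hpb (4 * n + 3 - j - 1) (j + 1) (by push_cast; ring) (by omega) (by omega)]
        simpa using hbDec (4 * n + 3 - j - 1) (by omega) (by omega)
      · obtain rfl : j = 4 * n + 4 := by omega
        have h1 : p (4 * n + 4 + 1) = 1 := by
          simp only [p]
          rw [if_neg (by omega), if_neg (by omega)]
        rw [h1]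
        convert hbm using 2
        push_cast; ring
  obtain ⟨lamP, lamM, hPs, hMs, hsign, hPl, hPr, hMl, hMr, hconst, hP, hM⟩ :=
    exists_lambda_of_monotone_nodes n p hp
      (by rwa [← hpa 0 0 rfl (by omega)])
      (by rwa [← hpb (-1) (4 * n + 4) (by push_cast; ring) (by omega) le_rfl])
  refine ⟨lamP, lamM, hPs.contDiffOn, hMs.contDiffOn, hsign, hPl, hPr, hMl, hMr,
    ?_, ?_, ?_, ?_, ?_, ?_⟩
  · intro i h1 h2
    lift i to ℕ using by omega
    have h := hconst (i - 1) (by omega)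
    rwa [← hpa (2 * i - 1) (2 * (i - 1) + 1) (by omega) (by omega),
      ← hpa (2 * i) (2 * (i - 1) + 2) (by omega) (by omega)] at h
  · intro i h1 h2
    lift i to ℕ using by omega
    have h := hconst (2 * n + 1 - i) (by omega)
    rwa [← hpb (2 * i) (2 * (2 * n + 1 - i) + 1) (by omega) (by omega) (by omega),
      ← hpb (2 * i - 1) (2 * (2 * n + 1 - i) + 2) (by omega) (by omega) (by omega)] at h
  · rintro _ ⟨x, rfl⟩ h1 h2
    lift x to ℕ using by omega
    rw [hpb _ (4 * (n - x) + 1) (by omega) (by omega) (by omega),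
      hpa _ (4 * x + 3) (by omega) (by omega), hpa _ (4 * x + 4) (by omega) (by omega)]
    exact hP (n - x) x (by omega)
  · rintro _ ⟨x, rfl⟩ h1 h2
    lift x to ℕ using by omega
    rw [hpa _ (4 * x + 1) (by omega) (by omega),
      hpb _ (4 * (n - x) + 3) (by omega) (by omega) (by omega),
      hpb _ (4 * (n - x) + 4) (by omega) (by omega) (by omega)]
    exact hP x (n - x) (by omega)
  · rintro _ ⟨x, rfl⟩ h1 h2
    lift x to ℕ using by omega
    rw [hpa _ (4 * x) (by omega) (by omega),
      hpb _ (4 * (n - x) + 1) (by omega) (by omega) (by omega),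
      hpb _ (4 * (n - x) + 2) (by omega) (by omega) (by omega)]
    exact hM x (n - x) (by omega)
  · rintro _ ⟨x, rfl⟩ h1 h2
    lift x to ℕ using by omega
    rw [hpb _ (4 * (n + 1 - x)) (by omega) (by omega) (by omega),
      hpa _ (4 * (x - 1) + 1) (by omega) (by omega),
      hpa _ (4 * (x - 1) + 2) (by omega) (by omega)]
    exact hM (n + 1 - x) (x - 1) (by omega)
end

section
/- Assume β(y) is defined for every y ∈ [a_0, b_{-1}] and the inclusions of Proposition 3 hold (for every i = 1,…,n+1: if i is odd, β([a_{2i-2}, a_{2i+1}]) ⋐ ω^b_i and β([b_{2i+1}, b_{2i-2}]) ⋐ ω^a_i; if i is even, [a_{2i-2}, a_{2i+1}] ⋐ β(ω^b_i) and [b_{2i+1}, b_{2i-2}] ⋐ β(ω^a_i)). Then there exists η > 0 such that for all continuous functions Q⁻, Q⁺ : [a_0, b_{-1}] → ℝ with |Q⁻(y) − β(y)| < η and |Q⁺(y) − β(y)| < η for all y ∈ [a_0, b_{-1}], the composition Q = Q⁺∘Q⁻ is well defined on each of the segments ω^a_i (i = 1,…,n+1), ω^b_i (i = 1,…,n) and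 on the gap segments [a_{2i}, a_{2i+1}], [b_{2i+1}, b_{2i}] (i = 0,…,n), Q has at least one fixed point in each segment ω^a_i (i = 1,…,n+1) and each segment ω^b_i (i = 1,…,n), and Q has no fixed point in [a_0, b_0] ∖ (⋃_{i=1}^{n}(ω^a_i ∪ ω^b_i) ∪ ω^a_{n+1}). -/
open Set

/-- Every value of `P` at a point of `J` to the right of `x` lies below `c`. -/
def BelowRightOf (J : Set ℝ) (P : ℝ → ℝ) (x c : ℝ) : Prop :=
  ∀ y ∈ J, x ≤ y → P y < c

/-- Every value of `P` at a point of `J` to the left of `x` lies above `c`. -/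
def AboveLeftOf (J : Set ℝ) (P : ℝ → ℝ) (x c : ℝ) : Prop :=
  ∀ y ∈ J, y ≤ x → c < P y

/-- The one-sided bounds on `P` that encode the inclusions for the `i`-th pair of segments when
`P` is decreasing. -/
structure TracksSegments (J : Set ℝ) (a b : ℤ → ℝ) (i : ℤ) (P : ℝ → ℝ) : Prop where
  odd_a_right : Odd i → BelowRightOf J P (a (2 * i - 2)) (b (2 * i - 1))
  odd_a_left : Odd i → AboveLeftOf J P (a (2 * i + 1)) (b (2 * i))
  odd_b_right : Odd i → BelowRightOf J P (b (2 * i + 1)) (a (2 * i))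
  odd_b_left : Odd i → AboveLeftOf J P (b (2 * i - 2)) (a (2 * i - 1))
  even_b_left : Even i → AboveLeftOf J P (b (2 * i)) (a (2 * i + 1))
  even_b_right : Even i → BelowRightOf J P (b (2 * i - 1)) (a (2 * i - 2))
  even_a_right : Even i → BelowRightOf J P (a (2 * i)) (b (2 * i + 1))
  even_a_left : Even i → AboveLeftOf J P (a (2 * i - 1)) (b (2 * i - 2))

/-- Sufficiently small perturbations of an antitone function inherit a strict upper bound. -/
theorem eventually_belowRightOf {J : Set ℝ} {f : ℝ → ℝ} (hf : AntitoneOn f J) {x c : ℝ}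
    (hx : x ∈ J) (h : f x < c) :
    ∀ᶠ η in nhdsWithin (0 : ℝ) (Ioi 0), ∀ P : ℝ → ℝ, (∀ y ∈ J, |P y - f y| < η) →
      BelowRightOf J P x c := by
  filter_upwards [Ioo_mem_nhdsGT (sub_pos.2 h)] with η hη P hP y hy hxy
  have h1 := hf hx hy hxy
  have h2 := (abs_lt.1 (hP y hy)).2
  linarith [hη.2]

/-- Sufficiently small perturbations of an antitone function inherit a strict lower bound. -/
theorem eventually_aboveLeftOf {J : Set ℝ} {f : ℝ → ℝ} (hf : AntitoneOn f J) {x c : ℝ}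
    (hx : x ∈ J) (h : c < f x) :
    ∀ᶠ η in nhdsWithin (0 : ℝ) (Ioi 0), ∀ P : ℝ → ℝ, (∀ y ∈ J, |P y - f y| < η) →
      AboveLeftOf J P x c := by
  filter_upwards [Ioo_mem_nhdsGT (sub_pos.2 h)] with η hη P hP y hy hxy
  have h1 := hf hy hx hxy
  have h2 := (abs_lt.1 (hP y hy)).1
  linarith [hη.2]

theorem lt_of_closure_image_Icc_subset {f : ℝ → ℝ} {l r u v : ℝ} (hlr : l ≤ r)
    (h : closure (f '' Icc l r) ⊆ interior (Icc u v)) : f l < v ∧ u < f r := by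
  rw [interior_Icc] at h
  exact ⟨(h (subset_closure (mem_image_of_mem f (left_mem_Icc.2 hlr)))).2,
    (h (subset_closure (mem_image_of_mem f (right_mem_Icc.2 hlr)))).1⟩

theorem AntitoneOn.lt_of_closure_Icc_subset {f : ℝ → ℝ} {l r u v : ℝ}
    (hf : AntitoneOn f (Icc l r)) (hlr : l ≤ r) (huv : u ≤ v)
    (h : closure (Icc u v) ⊆ interior (f '' Icc l r)) : v < f l ∧ f r < u := by
  have h1 : f '' Icc l r ⊆ Icc (f r) (f l) := by
    rintro _ ⟨y, hy, rfl⟩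
    exact ⟨hf hy (right_mem_Icc.2 hlr) hy.2, hf (left_mem_Icc.2 hlr) hy hy.1⟩
  have h2 : Icc u v ⊆ Ioo (f r) (f l) :=
    (subset_closure.trans h).trans ((interior_mono h1).trans interior_Icc.subset)
  exact ⟨(h2 (right_mem_Icc.2 huv)).2, (h2 (left_mem_Icc.2 huv)).1⟩

theorem exists_fixedPoint_of_inward {f : ℝ → ℝ} {l r : ℝ} (hlr : l ≤ r)
    (hf : ContinuousOn f (Icc l r)) (hl : l ≤ f l) (hr : f r ≤ r) : ∃ y ∈ Icc l r, f y = y := by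
  obtain ⟨y, hy, h⟩ := intermediate_value_Icc' hlr (hf.sub continuousOn_id)
    (show (0 : ℝ) ∈ Icc (f r - r) (f l - l) from ⟨sub_nonpos.2 hr, sub_nonneg.2 hl⟩)
  exact ⟨y, hy, sub_eq_zero.1 h⟩

theorem exists_fixedPoint_of_outward {f : ℝ → ℝ} {l r : ℝ} (hlr : l ≤ r)
    (hf : ContinuousOn f (Icc l r)) (hl : f l ≤ l) (hr : r ≤ f r) : ∃ y ∈ Icc l r, f y = y := by
  obtain ⟨y, hy, h⟩ := intermediate_value_Icc hlr (hf.sub continuousOn_id)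
    (show (0 : ℝ) ∈ Icc (f l - l) (f r - r) from ⟨sub_nonpos.2 hl, sub_nonneg.2 hr⟩)
  exact ⟨y, hy, sub_eq_zero.1 h⟩

theorem lt_of_lt_succ_of_int_range {a : ℤ → ℝ} {p q : ℤ}
    (h : ∀ i, p ≤ i → i < q → a i < a (i + 1)) {k m : ℤ} (hk : p ≤ k) (hkm : k < m)
    (hm : m ≤ q) : a k < a m := by
  revert hm
  induction m, (show k + 1 ≤ m from hkm) using Int.leInduction with
  | base => exact fun hm => h k hk (by lia)
  | succ m hkm' ih =>
    exact fun hm => (ih (by lia) (by lia)).trans (h m (by lia) (by lia))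

/-- A point between `a 0` and `a (2n+1)` lies in one of the even-to-odd gaps or in one of the
odd-to-even segments in between. -/
theorem exists_gap_or_segment {a : ℤ → ℝ} {y : ℝ} (h0 : a 0 ≤ y) (n : ℕ)
    (hn : y ≤ a (2 * (n : ℤ) + 1)) :
    (∃ i : ℤ, 0 ≤ i ∧ i ≤ n ∧ y ∈ Icc (a (2 * i)) (a (2 * i + 1))) ∨
      ∃ i : ℤ, 1 ≤ i ∧ i ≤ n ∧ y ∈ Icc (a (2 * i - 1)) (a (2 * i)) := by
  induction n with
  | zero => exact Or.inl ⟨0, le_rfl, le_rfl, by simpa using h0, by simpa using hn⟩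
  | succ n ih =>
    rcases le_total y (a (2 * (n : ℤ) + 1)) with h | h
    · rcases ih h with ⟨i, h1, h2, h3⟩ | ⟨i, h1, h2, h3⟩
      · exact Or.inl ⟨i, h1, by push_cast; lia, h3⟩
      · exact Or.inr ⟨i, h1, by push_cast; lia, h3⟩
    · rcases le_total y (a (2 * ((n : ℤ) + 1))) with h' | h'
      · refine Or.inr ⟨n + 1, by lia, by push_cast; lia, ?_, h'⟩
        rwa [show 2 * ((n : ℤ) + 1) - 1 = 2 * n + 1 by ring]
      · exact Or.inl ⟨n + 1, by lia, by push_cast; lia, h', by exact_mod_cast hn⟩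

theorem TracksSegments.exists_fixedPoint_a {J : Set ℝ} {a b : ℤ → ℝ} {i : ℤ}
    {P Q : ℝ → ℝ} (hP : TracksSegments J a b i P) (hQ : TracksSegments J a b i Q)
    (l1 : a (2 * i - 2) < a (2 * i - 1)) (l2 : a (2 * i - 1) < a (2 * i))
    (l3 : a (2 * i) < a (2 * i + 1)) (r1 : b (2 * i - 1) < b (2 * i - 2))
    (r3 : b (2 * i + 1) < b (2 * i))
    (hJ : Icc (a (2 * i - 1)) (a (2 * i)) ⊆ J)
    (hmaps : MapsTo P (Icc (a (2 * i - 1)) (a (2 * i))) J)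
    (hc : ContinuousOn (fun y => Q (P y)) (Icc (a (2 * i - 1)) (a (2 * i)))) :
    ∃ y ∈ Icc (a (2 * i - 1)) (a (2 * i)), Q (P y) = y := by
  have xl := left_mem_Icc.2 l2.le
  have xr := right_mem_Icc.2 l2.le
  rcases Int.even_or_odd i with he | he
  · refine exists_fixedPoint_of_outward l2.le hc ?_ ?_
    · have h := hP.even_a_left he _ (hJ xl) le_rfl
      exact (hQ.even_b_right he _ (hmaps xl) (by linarith)).le.trans l1.le
    · have h := hP.even_a_right he _ (hJ xr) le_rfl
      exact l3.le.trans (hQ.even_b_left he _ (hmaps xr) (by linarith)).le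
  · refine exists_fixedPoint_of_inward l2.le hc ?_ ?_
    · have h := hP.odd_a_right he _ (hJ xl) l1.le
      exact (hQ.odd_b_left he _ (hmaps xl) (by linarith)).le
    · have h := hP.odd_a_left he _ (hJ xr) l3.le
      exact (hQ.odd_b_right he _ (hmaps xr) (by linarith)).le

theorem TracksSegments.exists_fixedPoint_b {J : Set ℝ} {a b : ℤ → ℝ} {i : ℤ}
    {P Q : ℝ → ℝ} (hP : TracksSegments J a b i P) (hQ : TracksSegments J a b i Q)
    (l1 : a (2 * i - 2) < a (2 * i - 1)) (l3 : a (2 * i) < a (2 * i + 1))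
    (r1 : b (2 * i - 1) < b (2 * i - 2))
    (r2 : b (2 * i) < b (2 * i - 1)) (r3 : b (2 * i + 1) < b (2 * i))
    (hJ : Icc (b (2 * i)) (b (2 * i - 1)) ⊆ J)
    (hmaps : MapsTo P (Icc (b (2 * i)) (b (2 * i - 1))) J)
    (hc : ContinuousOn (fun y => Q (P y)) (Icc (b (2 * i)) (b (2 * i - 1)))) :
    ∃ y ∈ Icc (b (2 * i)) (b (2 * i - 1)), Q (P y) = y := by
  have xl := left_mem_Icc.2 r2.le
  have xr := right_mem_Icc.2 r2.le
  rcases Int.even_or_odd i with he | he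
  · refine exists_fixedPoint_of_outward r2.le hc ?_ ?_
    · have h := hP.even_b_left he _ (hJ xl) le_rfl
      exact (hQ.even_a_right he _ (hmaps xl) (by linarith)).le.trans r3.le
    · have h := hP.even_b_right he _ (hJ xr) le_rfl
      exact r1.le.trans (hQ.even_a_left he _ (hmaps xr) (by linarith)).le
  · refine exists_fixedPoint_of_inward r2.le hc ?_ ?_
    · have h := hP.odd_b_right he _ (hJ xl) r3.le
      exact (hQ.odd_a_left he _ (hmaps xl) (by linarith)).le
    · have h := hP.odd_b_left he _ (hJ xr) r1.le
      exact (hQ.odd_a_right he _ (hmaps xr) (by linarith)).le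

/-- If an antitone `f` satisfies the `i`-th inclusions, then all sufficiently small perturbations
of `f` satisfy the corresponding one-sided bounds. -/
theorem eventually_tracksSegments {f : ℝ → ℝ} {p q : ℝ} {a b : ℤ → ℝ} {i : ℤ}
    (hf : AntitoneOn f (Icc p q))
    (hAJ : ∀ k : ℤ, 2 * i - 2 ≤ k → k ≤ 2 * i + 1 → a k ∈ Icc p q)
    (hBJ : ∀ k : ℤ, 2 * i - 2 ≤ k → k ≤ 2 * i + 1 → b k ∈ Icc p q)
    (hA : ∀ k m : ℤ, 2 * i - 2 ≤ k → k < m → m ≤ 2 * i + 1 → a k < a m)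
    (hB : ∀ k m : ℤ, 2 * i - 2 ≤ k → k < m → m ≤ 2 * i + 1 → b m < b k)
    (hincl : (Odd i →
        closure (f '' Icc (a (2*i-2)) (a (2*i+1))) ⊆ interior (Icc (b (2*i)) (b (2*i-1))) ∧
        closure (f '' Icc (b (2*i+1)) (b (2*i-2))) ⊆ interior (Icc (a (2*i-1)) (a (2*i)))) ∧
      (Even i →
        closure (Icc (a (2*i-2)) (a (2*i+1))) ⊆ interior (f '' Icc (b (2*i)) (b (2*i-1))) ∧
        closure (Icc (b (2*i+1)) (b (2*i-2))) ⊆ interior (f '' Icc (a (2*i-1)) (a (2*i))))) :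
    ∀ᶠ η in nhdsWithin (0 : ℝ) (Ioi 0), ∀ P : ℝ → ℝ,
      (∀ y ∈ Icc p q, |P y - f y| < η) → TracksSegments (Icc p q) a b i P := by
  obtain ⟨ho, he⟩ := hincl
  have haa := (hA (2 * i - 2) (2 * i + 1) (by lia) (by lia) (by lia)).le
  have hbb := (hB (2 * i - 2) (2 * i + 1) (by lia) (by lia) (by lia)).le
  rcases Int.even_or_odd i with hp | hp
  · have hno : ¬ Odd i := Int.not_odd_iff_even.2 hp
    obtain ⟨h1, h2⟩ := he hp
    obtain ⟨e1, e2⟩ := (hf.mono (Icc_subset_Icc (hBJ _ (by lia) (by lia)).1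
      (hBJ _ (by lia) (by lia)).2)).lt_of_closure_Icc_subset
      (hB (2 * i - 1) (2 * i) (by lia) (by lia) (by lia)).le haa h1
    obtain ⟨e3, e4⟩ := (hf.mono (Icc_subset_Icc (hAJ _ (by lia) (by lia)).1
      (hAJ _ (by lia) (by lia)).2)).lt_of_closure_Icc_subset
      (hA (2 * i - 1) (2 * i) (by lia) (by lia) (by lia)).le hbb h2
    filter_upwards [eventually_aboveLeftOf hf (hBJ _ (by lia) (by lia)) e1,
      eventually_belowRightOf hf (hBJ _ (by lia) (by lia)) e2,
      eventually_aboveLeftOf hf (hAJ _ (by lia) (by lia)) e3,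
      eventually_belowRightOf hf (hAJ _ (by lia) (by lia)) e4] with η k1 k2 k3 k4 P hP
    exact ⟨fun h => absurd h hno, fun h => absurd h hno, fun h => absurd h hno,
      fun h => absurd h hno, fun _ => k1 P hP, fun _ => k2 P hP, fun _ => k4 P hP,
      fun _ => k3 P hP⟩
  · have hne : ¬ Even i := Int.not_even_iff_odd.2 hp
    obtain ⟨h1, h2⟩ := ho hp
    obtain ⟨e1, e2⟩ := lt_of_closure_image_Icc_subset haa h1
    obtain ⟨e3, e4⟩ := lt_of_closure_image_Icc_subset hbb h2
    filter_upwards [eventually_belowRightOf hf (hAJ _ (by lia) (by lia)) e1,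
      eventually_aboveLeftOf hf (hAJ _ (by lia) (by lia)) e2,
      eventually_belowRightOf hf (hBJ _ (by lia) (by lia)) e3,
      eventually_aboveLeftOf hf (hBJ _ (by lia) (by lia)) e4] with η k1 k2 k3 k4 P hP
    exact ⟨fun _ => k1 P hP, fun _ => k2 P hP, fun _ => k3 P hP, fun _ => k4 P hP,
      fun h => absurd h hne, fun h => absurd h hne, fun h => absurd h hne,
      fun h => absurd h hne⟩

/- STATEMENT 7 (fixed-point mechanism of Proposition 2 of the paper):
Assume β is defined on [a_0, b_{-1}] and the inclusions of Proposition 3 hold.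
Then there exists η > 0 such that for all continuous Q⁻, Q⁺ : [a_0, b_{-1}] → ℝ
with |Q⁻(y) − β(y)| < η and |Q⁺(y) − β(y)| < η on [a_0, b_{-1}], the composition
Q = Q⁺∘Q⁻ is well defined on each ω^a_i (i = 1,…,n+1), ω^b_i (i = 1,…,n) and on
the gap segments [a_{2i}, a_{2i+1}], [b_{2i+1}, b_{2i}] (i = 0,…,n) (i.e. Q⁻ maps
them into [a_0, b_{-1}]), Q has at least one fixed point in each ω^a_i
(i = 1,…,n+1) and ω^b_i (i = 1,…,n), and Q has no fixed point in
[a_0, b_0] ∖ (⋃_{i=1}^{n}(ω^a_i ∪ ω^b_i) ∪ ω^a_{n+1}). -/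
theorem perturbed_poincare_map_fixed_points
    (n : ℕ) (a b : ℤ → ℝ) (lamP lamM : ℝ → ℝ) (β : ℝ → ℝ)
    (hPc : ContinuousOn lamP (Icc (-1) 1))
    (hMc : ContinuousOn lamM (Icc (-1) 1))
    (hP : ∀ y ∈ Ioo (-1:ℝ) 1, 0 < lamP y)
    (hM : ∀ y ∈ Ioo (-1:ℝ) 1, lamM y < 0)
    (ham : a (-1) = -1)
    (haInc : ∀ i : ℤ, -1 ≤ i → i ≤ 2*(n:ℤ) → a i < a (i+1))
    (hab : a (2*(n:ℤ)+1) < b (2*(n:ℤ)+1))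
    (hbDec : ∀ i : ℤ, -1 ≤ i → i ≤ 2*(n:ℤ) → b (i+1) < b i)
    (hbm : b (-1) < 1)
    (hc1 : b (2*(n:ℤ)+2) = a (2*(n:ℤ)+1))
    (hc2 : a (2*(n:ℤ)+2) = b (2*(n:ℤ)+1))
    (hc3 : a (2*(n:ℤ)+3) = b (2*(n:ℤ)))
    (hc4 : b (2*(n:ℤ)+3) = a (2*(n:ℤ)))
    (hβ : ∀ y ∈ Icc (a 0) (b (-1)), β y ∈ Ioo (-1:ℝ) 1 ∧
      Phi lamM y 1 + Phi lamP (-1) (β y) = 0)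
    (hβcont : ContinuousOn β (Icc (a 0) (b (-1))))
    (hβanti : StrictAntiOn β (Icc (a 0) (b (-1))))
    (hincl : ∀ i : ℤ, 1 ≤ i → i ≤ (n:ℤ)+1 →
      (Odd i →
        closure (β '' Icc (a (2*i-2)) (a (2*i+1))) ⊆
          interior (Icc (b (2*i)) (b (2*i-1))) ∧
        closure (β '' Icc (b (2*i+1)) (b (2*i-2))) ⊆
          interior (Icc (a (2*i-1)) (a (2*i)))) ∧
      (Even i →
        closure (Icc (a (2*i-2)) (a (2*i+1))) ⊆
          interior (β '' Icc (b (2*i)) (b (2*i-1))) ∧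
        closure (Icc (b (2*i+1)) (b (2*i-2))) ⊆
          interior (β '' Icc (a (2*i-1)) (a (2*i))))) :
    ∃ η > 0, ∀ Qm Qp : ℝ → ℝ,
      ContinuousOn Qm (Icc (a 0) (b (-1))) →
      ContinuousOn Qp (Icc (a 0) (b (-1))) →
      (∀ y ∈ Icc (a 0) (b (-1)), |Qm y - β y| < η) →
      (∀ y ∈ Icc (a 0) (b (-1)), |Qp y - β y| < η) →
      -- Q = Q⁺∘Q⁻ is well defined on the segments ω^a_i, ω^b_i and the gaps:
      (∀ i : ℤ, 1 ≤ i → i ≤ (n:ℤ)+1 →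
        ∀ y ∈ Icc (a (2*i-1)) (a (2*i)), Qm y ∈ Icc (a 0) (b (-1))) ∧
      (∀ i : ℤ, 1 ≤ i → i ≤ (n:ℤ) →
        ∀ y ∈ Icc (b (2*i)) (b (2*i-1)), Qm y ∈ Icc (a 0) (b (-1))) ∧
      (∀ i : ℤ, 0 ≤ i → i ≤ (n:ℤ) →
        ∀ y ∈ Icc (a (2*i)) (a (2*i+1)), Qm y ∈ Icc (a 0) (b (-1))) ∧
      (∀ i : ℤ, 0 ≤ i → i ≤ (n:ℤ) →
        ∀ y ∈ Icc (b (2*i+1)) (b (2*i)), Qm y ∈ Icc (a 0) (b (-1))) ∧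
      -- Q has at least one fixed point in each ω^a_i and each ω^b_i:
      (∀ i : ℤ, 1 ≤ i → i ≤ (n:ℤ)+1 →
        ∃ y ∈ Icc (a (2*i-1)) (a (2*i)), Qp (Qm y) = y) ∧
      (∀ i : ℤ, 1 ≤ i → i ≤ (n:ℤ) →
        ∃ y ∈ Icc (b (2*i)) (b (2*i-1)), Qp (Qm y) = y) ∧
      -- Q has no fixed point in the complement of the ω's inside [a_0, b_0]:
      (∀ y ∈ Icc (a 0) (b 0),
        (∀ i : ℤ, 1 ≤ i → i ≤ (n:ℤ) →
          y ∉ Icc (a (2*i-1)) (a (2*i)) ∧ y ∉ Icc (b (2*i)) (b (2*i-1))) →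
        y ∉ Icc (a (2*(n:ℤ)+1)) (b (2*(n:ℤ)+1)) →
        Qp (Qm y) ≠ y) := by
  have ha' : ∀ i : ℤ, -1 ≤ i → i < 2 * (n : ℤ) + 3 → a i < a (i + 1) := by
    intro i h1 h2
    rcases (show i ≤ 2 * (n : ℤ) ∨ i = 2 * (n : ℤ) + 1 ∨ i = 2 * (n : ℤ) + 2 by omega) with
      h | rfl | rfl
    · exact haInc i h1 h
    · rw [show 2 * (n : ℤ) + 1 + 1 = 2 * n + 2 by ring, hc2]
      exact hab
    · rw [show 2 * (n : ℤ) + 2 + 1 = 2 * n + 3 by ring, hc2, hc3]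
      exact hbDec _ (by omega) le_rfl
  have hb' : ∀ i : ℤ, -1 ≤ i → i < 2 * (n : ℤ) + 3 → -b i < -b (i + 1) := by
    intro i h1 h2
    rw [neg_lt_neg_iff]
    rcases (show i ≤ 2 * (n : ℤ) ∨ i = 2 * (n : ℤ) + 1 ∨ i = 2 * (n : ℤ) + 2 by omega) with
      h | rfl | rfl
    · exact hbDec i h1 h
    · rw [show 2 * (n : ℤ) + 1 + 1 = 2 * n + 2 by ring, hc1]
      exact hab
    · rw [show 2 * (n : ℤ) + 2 + 1 = 2 * n + 3 by ring, hc1, hc4]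
      exact haInc _ (by omega) le_rfl
  have hA : ∀ k m : ℤ, -1 ≤ k → k < m → m ≤ 2 * (n : ℤ) + 3 → a k < a m :=
    fun k m hk hkm hm => lt_of_lt_succ_of_int_range ha' hk hkm hm
  have hB : ∀ k m : ℤ, -1 ≤ k → k < m → m ≤ 2 * (n : ℤ) + 3 → b m < b k :=
    fun k m hk hkm hm => neg_lt_neg_iff.1
      (lt_of_lt_succ_of_int_range (a := fun i => -b i) hb' hk hkm hm)
  have hA0 : ∀ k : ℤ, 0 ≤ k → k ≤ 2 * (n : ℤ) + 3 → a 0 ≤ a k ∧ a k ≤ b 0 := by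
    intro k h1 h2
    constructor
    · rcases h1.eq_or_lt with rfl | h
      exacts [le_rfl, (hA 0 k (by omega) h h2).le]
    · have h3 : b (2 * (n : ℤ)) ≤ b 0 := by
        rcases (show (0 : ℤ) = 2 * n ∨ (0 : ℤ) < 2 * n by omega) with h | h
        exacts [by rw [← h], (hB 0 _ (by omega) h (by omega)).le]
      rw [← hc3] at h3
      rcases h2.eq_or_lt with rfl | h
      exacts [h3, (hA k _ (by omega) h le_rfl).le.trans h3]
  have hB0 : ∀ k : ℤ, 0 ≤ k → k ≤ 2 * (n : ℤ) + 3 → a 0 ≤ b k ∧ b k ≤ b 0 := by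
    intro k h1 h2
    constructor
    · have h3 : a 0 ≤ a (2 * (n : ℤ)) := (hA0 _ (by omega) (by omega)).1
      rw [← hc4] at h3
      rcases h2.eq_or_lt with rfl | h
      exacts [h3, h3.trans (hB k _ (by omega) h le_rfl).le]
    · rcases h1.eq_or_lt with rfl | h
      exacts [le_rfl, (hB 0 k (by omega) h h2).le]
  have hb0 : b 0 ≤ b (-1) := (hB (-1) 0 le_rfl (by omega) (by omega)).le
  set J := Icc (a 0) (b (-1)) with hJ
  have hI : ∀ {y}, y ∈ Icc (a 0) (b 0) → y ∈ J := fun h => ⟨h.1, h.2.trans hb0⟩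
  have hAJ : ∀ k : ℤ, 0 ≤ k → k ≤ 2 * (n : ℤ) + 3 → a k ∈ J := fun k h1 h2 => hI (hA0 k h1 h2)
  have hBJ : ∀ k : ℤ, 0 ≤ k → k ≤ 2 * (n : ℤ) + 3 → b k ∈ J := fun k h1 h2 => hI (hB0 k h1 h2)
  have hanti : AntitoneOn β J := hβanti.antitoneOn
  have hev : ∀ i ∈ Finset.Icc (1 : ℤ) (n + 1), ∀ᶠ η in nhdsWithin (0 : ℝ) (Ioi 0),
      ∀ P : ℝ → ℝ, (∀ y ∈ J, |P y - β y| < η) → TracksSegments J a b i P := by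
    intro i hi
    obtain ⟨hi1, hi2⟩ := Finset.mem_Icc.1 hi
    exact eventually_tracksSegments hanti (fun k h1 h2 => hAJ k (by omega) (by omega))
      (fun k h1 h2 => hBJ k (by omega) (by omega))
      (fun k m h1 h2 h3 => hA k m (by omega) h2 (by omega))
      (fun k m h1 h2 h3 => hB k m (by omega) h2 (by omega)) (hincl i hi1 hi2)
  obtain ⟨η, hη, hpos⟩ :=
    (((Finset.eventually_all _).2 hev).and self_mem_nhdsWithin).exists
  refine ⟨η, hpos, fun Qm Qp hmc hpc hmβ hpβ => ?_⟩
  have tm : ∀ i : ℤ, 1 ≤ i → i ≤ (n : ℤ) + 1 → TracksSegments J a b i Qm :=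
    fun i h1 h2 => hη i (Finset.mem_Icc.2 ⟨h1, h2⟩) Qm hmβ
  have tp : ∀ i : ℤ, 1 ≤ i → i ≤ (n : ℤ) + 1 → TracksSegments J a b i Qp :=
    fun i h1 h2 => hη i (Finset.mem_Icc.2 ⟨h1, h2⟩) Qp hpβ
  have hm1 := tm 1 le_rfl (by omega)
  have hp1 := tp 1 le_rfl (by omega)
  have hbound : ∀ P : ℝ → ℝ, TracksSegments J a b 1 P → ∀ y ∈ Icc (a 0) (b 0),
      a 1 < P y ∧ P y < b 1 := fun P h y hy =>
    ⟨by simpa using h.odd_b_left odd_one y (hI hy) (by simpa using hy.2),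
      by simpa using h.odd_a_right odd_one y (hI hy) (by simpa using hy.1)⟩
  have ha1 := hA0 1 (by omega) (by omega)
  have hb1 := hB0 1 (by omega) (by omega)
  have hmaps : MapsTo Qm (Icc (a 0) (b 0)) (Icc (a 0) (b 0)) := fun y hy =>
    ⟨ha1.1.trans (hbound Qm hm1 y hy).1.le, (hbound Qm hm1 y hy).2.le.trans hb1.2⟩
  have hQc : ContinuousOn (fun y => Qp (Qm y)) (Icc (a 0) (b 0)) :=
    hpc.comp (hmc.mono fun y => hI) fun y hy => hI (hmaps hy)
  have hAI : ∀ k m : ℤ, 0 ≤ k → k ≤ 2 * (n : ℤ) + 3 → 0 ≤ m → m ≤ 2 * (n : ℤ) + 3 →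
      Icc (a k) (a m) ⊆ Icc (a 0) (b 0) :=
    fun k m h1 h2 h3 h4 => Icc_subset_Icc (hA0 k h1 h2).1 (hA0 m h3 h4).2
  have hBI : ∀ k m : ℤ, 0 ≤ k → k ≤ 2 * (n : ℤ) + 3 → 0 ≤ m → m ≤ 2 * (n : ℤ) + 3 →
      Icc (b k) (b m) ⊆ Icc (a 0) (b 0) :=
    fun k m h1 h2 h3 h4 => Icc_subset_Icc (hB0 k h1 h2).1 (hB0 m h3 h4).2
  refine ⟨fun i h1 h2 y hy => hI (hmaps (hAI _ _ (by omega) (by omega) (by omega) (by omega) hy)),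
    fun i h1 h2 y hy => hI (hmaps (hBI _ _ (by omega) (by omega) (by omega) (by omega) hy)),
    fun i h1 h2 y hy => hI (hmaps (hAI _ _ (by omega) (by omega) (by omega) (by omega) hy)),
    fun i h1 h2 y hy => hI (hmaps (hBI _ _ (by omega) (by omega) (by omega) (by omega) hy)),
    fun i h1 h2 => ?_, fun i h1 h2 => ?_, fun y hy hout hmid => ?_⟩
  · have hsub := hAI (2 * i - 1) (2 * i) (by omega) (by omega) (by omega) (by omega)
    exact (tm i h1 (by omega)).exists_fixedPoint_a (tp i h1 (by omega))
      (hA _ _ (by omega) (by omega) (by omega)) (hA _ _ (by omega) (by omega) (by omega))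
      (hA _ _ (by omega) (by omega) (by omega)) (hB _ _ (by omega) (by omega) (by omega))
      (hB _ _ (by omega) (by omega) (by omega))
      (fun y hy => hI (hsub hy)) (fun y hy => hI (hmaps (hsub hy))) (hQc.mono hsub)
  · have hsub := hBI (2 * i) (2 * i - 1) (by omega) (by omega) (by omega) (by omega)
    exact (tm i h1 (by omega)).exists_fixedPoint_b (tp i h1 (by omega))
      (hA _ _ (by omega) (by omega) (by omega)) (hA _ _ (by omega) (by omega) (by omega))
      (hB _ _ (by omega) (by omega) (by omega)) (hB _ _ (by omega) (by omega) (by omega))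
      (hB _ _ (by omega) (by omega) (by omega))
      (fun y hy => hI (hsub hy)) (fun y hy => hI (hmaps (hsub hy))) (hQc.mono hsub)
  · have hyJ := hI hy
    have hQJ := hI (hmaps hy)
    rcases le_total y (a (2 * (n : ℤ) + 1)) with hya | hya
    · rcases exists_gap_or_segment hy.1 n hya with ⟨i, h1, h2, h3⟩ | ⟨i, h1, h2, h3⟩
      swap
      · exact absurd h3 (hout i h1 h2).1
      rcases h1.eq_or_lt with rfl | h1
      · have h4 : y ≤ a 1 := by simpa using h3.2
        exact (h4.trans_lt (hbound Qp hp1 _ (hmaps hy)).1).ne'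
      have r3 := hB (2 * i) (2 * i + 1) (by omega) (by omega) (by omega)
      have sm := tm i h1 (by omega)
      have sp := tp i h1 (by omega)
      rcases Int.even_or_odd i with hp | hp
      · have h := sm.even_a_right hp _ hyJ h3.1
        exact (h3.2.trans_lt (sp.even_b_left hp _ hQJ (by linarith))).ne'
      · have h := sm.odd_a_left hp _ hyJ h3.2
        exact ((sp.odd_b_right hp _ hQJ (by linarith)).trans_le h3.1).ne
    · have hyb : b (2 * (n : ℤ) + 1) ≤ y := by
        by_contra! h
        exact hmid ⟨hya, h.le⟩
      rcases exists_gap_or_segment (a := fun i => -b i) (neg_le_neg hy.2) n (neg_le_neg hyb) with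
        ⟨i, h1, h2, h3⟩ | ⟨i, h1, h2, h3⟩
      swap
      · exact absurd ⟨neg_le_neg_iff.1 h3.2, neg_le_neg_iff.1 h3.1⟩ (hout i h1 h2).2
      have h4 := neg_le_neg_iff.1 h3.1
      have h5 := neg_le_neg_iff.1 h3.2
      rcases h1.eq_or_lt with rfl | h1
      · have h6 : b 1 ≤ y := by simpa using h5
        exact ((hbound Qp hp1 _ (hmaps hy)).2.trans_le h6).ne
      have l3 := hA (2 * i) (2 * i + 1) (by omega) (by omega) (by omega)
      have sm := tm i h1 (by omega)
      have sp := tp i h1 (by omega)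
      rcases Int.even_or_odd i with hp | hp
      · have h := sm.even_b_left hp _ hyJ h4
        exact ((sp.even_a_right hp _ hQJ (by linarith)).trans_le h5).ne
      · have h := sm.odd_b_right hp _ hyJ h5
        exact (h4.trans_lt (sp.odd_a_left hp _ hQJ (by linarith))).ne'
end

section
/- Let F : ℝ × ℝ → ℝ be continuously differentiable in (x,y), let ξ₋ < ξ₊ and c > 0, and let φ : [ξ₋, ξ₊] × [0,c] → ℝ be twice continuously differentiable such that for every x₀ ∈ [0,c] the curve y ↦ φ(y, x₀) solves the differential equation ∂φ/∂y (y, x₀) = F(φ(y, x₀), y) with initial condition φ(ξ₋, x₀) = x₀. If φ(ξ₊, c) − φ(ξ₊, 0) = c, then there exists x* ∈ (0, c) such that ∫_{ξ₋}^{ξ₊} (∂F/∂x)(φ(y, x*), y) dy = 0. -/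
open Set intervalIntegral in
/-- A continuous solution of the integral form of `v' = a v` is given by the exponential of the
primitive of `a`. -/
theorem eq_mul_exp_integral_of_integral_equation {a v : ℝ → ℝ} {α β v₀ : ℝ} (hαβ : α ≤ β)
    (ha : ContinuousOn a (Icc α β)) (hv : ContinuousOn v (Icc α β))
    (h : ∀ y ∈ Icc α β, v y = v₀ + ∫ s in α..y, a s * v s) :
    v β = v₀ * Real.exp (∫ s in α..β, a s) := by
  set A : ℝ → ℝ := IccExtend hαβ ((Icc α β).domRestrict a) with hA
  set W : ℝ → ℝ := IccExtend hαβ ((Icc α β).domRestrict v) with hW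
  have hAc : Continuous A := (continuousOn_iff_continuous_domRestrict.1 ha).Icc_extend'
  have hWc : Continuous W := (continuousOn_iff_continuous_domRestrict.1 hv).Icc_extend'
  have hAe : ∀ y ∈ Icc α β, A y = a y := fun y hy => by
    simp [hA, IccExtend_of_mem hαβ _ hy]
  have hWe : ∀ y ∈ Icc α β, W y = v y := fun y hy => by
    simp [hW, IccExtend_of_mem hαβ _ hy]
  have hsub : ∀ y ∈ Icc α β, ∀ s ∈ uIcc α y, s ∈ Icc α β := fun y hy s hs => by
    rw [uIcc_of_le hy.1] at hs
    exact ⟨hs.1, hs.2.trans hy.2⟩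
  have hw : ∀ y ∈ Icc α β, v y = v₀ + ∫ s in α..y, A s * W s := fun y hy => by
    rw [h y hy]
    congr 1
    exact integral_congr fun s hs => by
      simp only [hAe s (hsub y hy s hs), hWe s (hsub y hy s hs)]
  have hI : (∫ s in α..β, a s) = ∫ s in α..β, A s :=
    integral_congr fun s hs => (hAe s (hsub β (right_mem_Icc.2 hαβ) s hs)).symm
  set g : ℝ → ℝ := fun y => (v₀ + ∫ s in α..y, A s * W s) * Real.exp (-∫ s in α..y, A s) with hg
  have hgd : ∀ y, HasDerivAt g (A y * W y * Real.exp (-∫ s in α..y, A s) +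
      (v₀ + ∫ s in α..y, A s * W s) * (Real.exp (-∫ s in α..y, A s) * -A y)) y := fun y =>
    (((hAc.mul hWc).integral_hasStrictDerivAt α y).hasDerivAt.const_add v₀).mul
      (hAc.integral_hasStrictDerivAt α y).hasDerivAt.neg.exp
  have hconst := constant_of_has_deriv_right_zero (f := g) (a := α) (b := β)
    (fun y _ => (hgd y).continuousAt.continuousWithinAt)
    (fun y hy => by
      have hy' := Ico_subset_Icc_self hy
      convert (hgd y).hasDerivWithinAt using 1
      rw [← hw y hy', hWe y hy']
      ring) β (right_mem_Icc.2 hαβ)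
  simp only [hg, integral_same, add_zero, neg_zero, Real.exp_zero, mul_one] at hconst
  rw [← hw β (right_mem_Icc.2 hαβ)] at hconst
  rw [hI, ← hconst, mul_assoc, ← Real.exp_add, neg_add_cancel, Real.exp_zero, mul_one]

open Set in
/-- The partial derivative in the second variable of a function differentiable on a rectangle. -/
theorem HasFDerivWithinAt.hasDerivAt_snd_of_rectangle {φ : ℝ × ℝ → ℝ} {φ' : ℝ × ℝ →L[ℝ] ℝ}
    {α β p q y x : ℝ} (h : HasFDerivWithinAt φ φ' (Icc α β ×ˢ Icc p q) (y, x))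
    (hy : y ∈ Icc α β) (hx : x ∈ Ioo p q) :
    HasDerivAt (fun t => φ (y, t)) (φ' (0, 1)) x :=
  (h.comp_hasDerivWithinAt x ((hasDerivAt_const x y).prodMk (hasDerivAt_id x)).hasDerivWithinAt
    (fun _ ht => mk_mem_prod hy ht)).hasDerivAt (Icc_mem_nhds hx.1 hx.2)

/-- The partial derivative in the first variable. -/
theorem DifferentiableAt.hasDerivAt_fst {F : ℝ × ℝ → ℝ} {x y : ℝ}
    (h : DifferentiableAt ℝ F (x, y)) :
    HasDerivAt (fun t => F (t, y)) (fderiv ℝ F (x, y) (1, 0)) x :=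
  h.hasFDerivAt.comp_hasDerivAt x ((hasDerivAt_id x).prodMk (hasDerivAt_const x y))

open Set intervalIntegral MeasureTheory in
/-- The equation in variations for `∂φ/∂y = F(φ, y)`, solved: the derivative of the flow with
respect to the initial condition. -/
theorem fderivWithin_flow_eq_exp_integral {F φ : ℝ × ℝ → ℝ} (hF : ContDiff ℝ 1 F)
    {α β p q : ℝ} (hαβ : α < β) (hpq : p < q)
    (hφ : ContDiffOn ℝ 1 φ (Icc α β ×ˢ Icc p q))
    (hode : ∀ x ∈ Icc p q, ∀ y ∈ Icc α β,
      HasDerivAt (fun s => φ (s, x)) (F (φ (y, x), y)) y)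
    (hinit : ∀ x ∈ Icc p q, φ (α, x) = x) {x : ℝ} (hx : x ∈ Ioo p q) :
    fderivWithin ℝ φ (Icc α β ×ˢ Icc p q) (β, x) (0, 1) =
      Real.exp (∫ y in α..β, deriv (fun t => F (t, y)) (φ (y, x))) := by
  set R := Icc α β ×ˢ Icc p q with hR
  set V : ℝ × ℝ → ℝ := fun z => fderivWithin ℝ φ R z (0, 1) with hV
  set D : ℝ × ℝ → ℝ := fun z => fderiv ℝ F (φ z, z.1) (1, 0) with hD
  have hRu : UniqueDiffOn ℝ R := (uniqueDiffOn_Icc hαβ).prod (uniqueDiffOn_Icc hpq)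
  have hVc : ContinuousOn V R :=
    (hφ.continuousOn_fderivWithin hRu le_rfl).clm_apply continuousOn_const
  have hpair : ContinuousOn (fun z : ℝ × ℝ => (φ z, z.1)) R :=
    hφ.continuousOn.prodMk continuousOn_fst
  have hDc : ContinuousOn D R :=
    ((hF.continuous_fderiv one_ne_zero).comp_continuousOn hpair).clm_apply continuousOn_const
  have hFc : ContinuousOn (fun z => F (φ z, z.1)) R := hF.continuous.comp_continuousOn hpair
  have slice : ∀ {g : ℝ × ℝ → ℝ}, ContinuousOn g R → ∀ t ∈ Icc p q,
      ContinuousOn (fun s => g (s, t)) (Icc α β) := fun hg t ht =>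
    hg.comp (by fun_prop) fun s hs => mk_mem_prod hs ht
  have hVd : ∀ y ∈ Icc α β, ∀ t ∈ Ioo p q, HasDerivAt (fun t => φ (y, t)) (V (y, t)) t :=
    fun y hy t ht =>
      ((hφ.differentiableOn one_ne_zero (y, t)
        ⟨hy, Ioo_subset_Icc_self ht⟩).hasFDerivWithinAt).hasDerivAt_snd_of_rectangle hy ht
  have hFd : ∀ a b, HasDerivAt (fun t => F (t, b)) (fderiv ℝ F (a, b) (1, 0)) a := fun a b =>
    (hF.differentiable one_ne_zero (a, b)).hasDerivAt_fst
  have hsub : ∀ y ∈ Icc α β, uIcc α y ⊆ Icc α β := fun y hy => by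
    rw [uIcc_of_le hy.1]
    exact Icc_subset_Icc_right hy.2
  have hsub' : ∀ y ∈ Icc α β, uIoc α y ⊆ Icc α β := fun y hy =>
    uIoc_subset_uIcc.trans (hsub y hy)
  have hx' := Ioo_subset_Icc_self hx
  obtain ⟨C, hC⟩ := ((isCompact_Icc.prod isCompact_Icc).exists_bound_of_continuousOn
    (hDc.mul hVc) : ∃ C, ∀ z ∈ R, ‖D z * V z‖ ≤ C)
  have key : ∀ y ∈ Icc α β, V (y, x) = 1 + ∫ s in α..y, D (s, x) * V (s, x) := by
    intro y hy
    have hmeas : ∀ {g : ℝ × ℝ → ℝ}, ContinuousOn g R → ∀ t ∈ Icc p q,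
        AEStronglyMeasurable (fun s => g (s, t)) (volume.restrict (uIoc α y)) := fun hg t ht =>
      ((slice hg t ht).mono (hsub' y hy)).aestronglyMeasurable measurableSet_uIoc
    have hint : ∀ t ∈ Icc p q, IntervalIntegrable (fun s => F (φ (s, t), s)) volume α y :=
      fun t ht => ((slice hFc t ht).mono (hsub y hy)).intervalIntegrable
    have hder := (intervalIntegral.hasDerivAt_integral_of_dominated_loc_of_deriv_le
      (μ := volume) (a := α) (b := y) (F := fun t s => F (φ (s, t), s))
      (F' := fun t s => D (s, t) * V (s, t)) (x₀ := x) (bound := fun _ => C)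
      (Ioo_mem_nhds hx.1 hx.2)
      (Filter.eventually_of_mem (Icc_mem_nhds hx.1 hx.2) fun t ht => hmeas hFc t ht)
      (hint x hx') (hmeas (hDc.mul hVc) x hx')
      (Filter.Eventually.of_forall fun s hs t ht =>
        hC (s, t) ⟨hsub' y hy hs, Ioo_subset_Icc_self ht⟩)
      intervalIntegrable_const
      (Filter.Eventually.of_forall fun s hs t ht =>
        HasDerivAt.comp (h₂ := fun u => F (u, s)) t (hFd (φ (s, t)) s) (hVd s (hsub' y hy hs) t ht))).2
    have heq : (fun t => φ (y, t)) =ᶠ[nhds x]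
        fun t => t + ∫ s in α..y, F (φ (s, t), s) :=
      Filter.eventually_of_mem (Icc_mem_nhds hx.1 hx.2) fun t ht => by
        have := integral_eq_sub_of_hasDerivAt
          (fun s hs => hode t ht s (hsub y hy hs)) (hint t ht)
        simp only [this, hinit t ht]
        ring
    exact (hVd y hy x hx).unique (((hasDerivAt_id x).add hder).congr_of_eventuallyEq heq)
  have := eq_mul_exp_integral_of_integral_equation hαβ.le (slice hDc x hx') (slice hVc x hx') key
  rw [one_mul] at this
  simp only [(hFd _ _).deriv]
  exact this

/- STATEMENT 9 (Proposition 6 of the paper, via the equation in variations):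
Let F : ℝ × ℝ → ℝ be C¹, ξ₋ < ξ₊, c > 0, and let φ : [ξ₋,ξ₊] × [0,c] → ℝ be C²
such that for every x₀ ∈ [0,c] the curve y ↦ φ(y,x₀) solves
∂φ/∂y (y,x₀) = F(φ(y,x₀), y) with φ(ξ₋,x₀) = x₀. If φ(ξ₊,c) − φ(ξ₊,0) = c, then
there exists x* ∈ (0,c) with ∫_{ξ₋}^{ξ₊} F'_x(φ(y,x*), y) dy = 0. -/
theorem exists_trajectory_with_zero_mean_variation
    (F : ℝ × ℝ → ℝ) (hF : ContDiff ℝ 1 F)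
    (ξm ξp c : ℝ) (hξ : ξm < ξp) (hc : 0 < c)
    (φ : ℝ × ℝ → ℝ)
    (hφ : ContDiffOn ℝ 2 φ (Set.Icc ξm ξp ×ˢ Set.Icc 0 c))
    (hode : ∀ x₀ ∈ Set.Icc (0:ℝ) c, ∀ y ∈ Set.Icc ξm ξp,
      HasDerivAt (fun s => φ (s, x₀)) (F (φ (y, x₀), y)) y)
    (hinit : ∀ x₀ ∈ Set.Icc (0:ℝ) c, φ (ξm, x₀) = x₀)
    (hdiff : φ (ξp, c) - φ (ξp, 0) = c) :
    ∃ xs ∈ Set.Ioo (0:ℝ) c,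
      (∫ y in ξm..ξp, deriv (fun x => F (x, y)) (φ (y, xs))) = 0 := by
  have hφ₁ : ContDiffOn ℝ 1 φ (Set.Icc ξm ξp ×ˢ Set.Icc 0 c) := hφ.of_le one_le_two
  have hξp : ξp ∈ Set.Icc ξm ξp := Set.right_mem_Icc.2 hξ.le
  obtain ⟨x, hx, hslope⟩ := exists_hasDerivAt_eq_slope (fun t => φ (ξp, t))
    (fun t => fderivWithin ℝ φ (Set.Icc ξm ξp ×ˢ Set.Icc 0 c) (ξp, t) (0, 1)) hc
    (hφ.continuousOn.comp (by fun_prop) fun t ht => Set.mk_mem_prod hξp ht)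
    (fun t ht => ((hφ₁.differentiableOn one_ne_zero (ξp, t)
      ⟨hξp, Set.Ioo_subset_Icc_self ht⟩).hasFDerivWithinAt).hasDerivAt_snd_of_rectangle hξp ht)
  refine ⟨x, hx, ?_⟩
  rw [fderivWithin_flow_eq_exp_integral hF hξ hc hφ₁ hode hinit hx, hdiff, sub_zero,
    div_self hc.ne', Real.exp_eq_one_iff] at hslope
  exact hslope
end
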